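/- arXiv:2302.12603 — 3 statements merged into one kernel-verified Lean document; each statement's English description precedes it below -/
import Mathlib

section
/- Assume the linear equation x' = A(t)x has no nonzero bounded solution on ℝ, that q < 1, and that L < ∞. Suppose that for each λ ∈ Σ, y_λ : ℝ → X is continuously differentiable and satisfies |y_λ'(t) − A(t)y_λ(t) − f_λ(t, y_λ(t))| ≤ ε(t) for all t ∈ ℝ. Then for each λ ∈ Σ there exists a unique differentiable map x_λ : ℝ → X with x_λ'(t) = A(t)x_λ(t) + f_λ(t, x_λ(t)) for all t ∈ ℝ and sup_{t∈ℝ} |x_λ(t) − y_λ(t)| ≤ L/(1−q). -/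
open MeasureTheory Set

section Evolution

variable {X : Type*} [NormedAddCommGroup X] [NormedSpace ℝ X]
  {A : ℝ → X →L[ℝ] X} {T : ℝ → ℝ → X →L[ℝ] X}

/-- Uniqueness for linear operator equations `U' = A(t) U` with continuous coefficients. -/
theorem eq_of_hasDerivAt_clm_comp (hA : Continuous A) {U V : ℝ → X →L[ℝ] X}
    (hU : ∀ t, HasDerivAt U ((A t).comp (U t)) t) (hV : ∀ t, HasDerivAt V ((A t).comp (V t)) t)
    {τ : ℝ} (h : U τ = V τ) (t : ℝ) : U t = V t := by
  set a := min t τ - 1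
  set b := max t τ + 1
  obtain ⟨K, hK⟩ := (isCompact_Icc (a := a) (b := b)).exists_bound_of_continuousOn hA.continuousOn
  have hat : a < t := by have := min_le_left t τ; simp only [a]; linarith
  have haτ : a < τ := by have := min_le_right t τ; simp only [a]; linarith
  have htb : t < b := by have := le_max_left t τ; simp only [b]; linarith
  have hτb : τ < b := by have := le_max_right t τ; simp only [b]; linarith
  have hEq : EqOn U V (Icc a b) := by
    refine ODE_solution_unique_of_mem_Icc (v := fun t W => (A t).comp W) (s := fun _ => univ)
      (K := K.toNNReal) (t₀ := τ) (fun r hr => ?_) ⟨haτ, hτb⟩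
      (fun r _ => (hU r).continuousAt.continuousWithinAt) (fun r _ => hU r) (fun _ _ => mem_univ _)
      (fun r _ => (hV r).continuousAt.continuousWithinAt) (fun r _ => hV r) (fun _ _ => mem_univ _) h
    refine (LipschitzWith.of_dist_le_mul fun W₁ W₂ => ?_).lipschitzOnWith
    rw [dist_eq_norm, dist_eq_norm, ← ContinuousLinearMap.comp_sub]
    refine (ContinuousLinearMap.opNorm_comp_le _ _).trans ?_
    gcongr
    exact (hK r ⟨hr.1.le, hr.2.le⟩).trans (Real.le_coe_toNNReal K)
  exact hEq ⟨hat.le, htb.le⟩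

theorem evolution_comp (hA : Continuous A) (hTid : ∀ s, T s s = 1)
    (hT : ∀ s t, HasDerivAt (fun r => T r s) ((A t).comp (T t s)) t) (t τ s : ℝ) :
    (T t τ).comp (T τ s) = T t s := by
  refine eq_of_hasDerivAt_clm_comp hA (U := fun r => (T r τ).comp (T τ s)) (V := fun r => T r s)
    (τ := τ) (fun r => ?_) (hT s) ?_ t
  · have := (hT τ r).clm_comp (hasDerivAt_const r (T τ s))
    simpa [ContinuousLinearMap.comp_assoc] using this
  · simp only [hTid]
    exact ContinuousLinearMap.id_comp _

theorem continuous_evolution_right [CompleteSpace X] (hA : Continuous A)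
    (hTid : ∀ s, T s s = 1)
    (hT : ∀ s t, HasDerivAt (fun r => T r s) ((A t).comp (T t s)) t) (t : ℝ) :
    Continuous (T t) := by
  have hmul : ∀ a b, T a b * T b a = 1 := fun a b =>
    (evolution_comp hA hTid hT a b a).trans (hTid a)
  let u : ℝ → (X →L[ℝ] X)ˣ := fun s => ⟨T s t, T t s, hmul s t, hmul t s⟩
  have hinv : T t = fun s => Ring.inverse (T s t) := by
    funext s
    exact (Ring.inverse_unit (u s)).symm
  rw [hinv, continuous_iff_continuousAt]
  intro s
  exact ContinuousAt.comp (f := fun s => T s t)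
    (NormedRing.inverse_continuousAt (u s)) (hT t s).continuousAt

end Evolution

section Green

variable {X : Type*} [NormedAddCommGroup X] [NormedSpace ℝ X] [CompleteSpace X]
  {A : ℝ → X →L[ℝ] X} {T : ℝ → ℝ → X →L[ℝ] X} {P : ℝ → X →L[ℝ] X} {G : ℝ → ℝ → X →L[ℝ] X}

theorem aestronglyMeasurable_green_apply (hA : Continuous A) (hTid : ∀ s, T s s = 1)
    (hT : ∀ s t, HasDerivAt (fun r => T r s) ((A t).comp (T t s)) t) (hP : Continuous P)
    (hG : ∀ t s, G t s = if s ≤ t then (T t s).comp (P s) else -((T t s).comp (1 - P s)))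
    {g : ℝ → X} (hg : Continuous g) (t : ℝ) :
    AEStronglyMeasurable (fun s => G t s (g s)) := by
  have hTc := continuous_evolution_right hA hTid hT t
  have hGm : StronglyMeasurable (G t) := by
    rw [show G t = _ from funext (hG t)]
    exact StronglyMeasurable.ite measurableSet_Iic (hTc.clm_comp hP).stronglyMeasurable
      (hTc.clm_comp (continuous_const.sub hP)).neg.stronglyMeasurable
  exact (isBoundedBilinearMap_apply.continuous.comp_stronglyMeasurable
    (hGm.prodMk hg.stronglyMeasurable)).aestronglyMeasurable

/-- The Green operator solves the inhomogeneous linear equation. -/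
theorem hasDerivAt_integral_green (hA : Continuous A) (hTid : ∀ s, T s s = 1)
    (hT : ∀ s t, HasDerivAt (fun r => T r s) ((A t).comp (T t s)) t)
    (hG : ∀ t s, G t s = if s ≤ t then (T t s).comp (P s) else -((T t s).comp (1 - P s)))
    {g : ℝ → X} (hg : Continuous g) (hint : ∀ t, Integrable (fun s => G t s (g s))) (t : ℝ) :
    HasDerivAt (fun t => ∫ s, G t s (g s)) (A t (∫ s, G t s (g s)) + g t) t := by
  have hcomp : ∀ t τ s v, T t τ (T τ s v) = T t s v := fun t τ s v =>
    congrArg (fun S => S v) (evolution_comp hA hTid hT t τ s)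
  have hone : ∀ s v, T s s v = v := fun s v => by rw [hTid]; rfl
  have hk : ∀ t s, T 0 t (G t s (g s)) =
      if s ≤ t then T 0 s (P s (g s)) else T 0 s (P s (g s)) - T 0 s (g s) := by
    intro t s
    rw [hG]
    split_ifs <;> simp [hcomp]
  have hh : Continuous fun s => T 0 s (g s) :=
    (continuous_evolution_right hA hTid hT 0).clm_apply hg
  have hki : ∀ t, Integrable fun s => T 0 t (G t s (g s)) := fun t =>
    (T 0 t).integrable_comp (hint t)
  have hdiff : ∀ a b, a ≤ b → (∫ s, T 0 b (G b s (g s))) - ∫ s, T 0 a (G a s (g s)) =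
      ∫ s in a..b, T 0 s (g s) := by
    intro a b hab
    rw [← integral_sub (hki b) (hki a), intervalIntegral.integral_of_le hab,
      ← integral_indicator measurableSet_Ioc]
    congr 1
    funext s
    rw [hk, hk, indicator_apply]
    by_cases h₁ : s ≤ a
    · simp [h₁, h₁.trans hab, mem_Ioc, not_lt.2 h₁]
    · by_cases h₂ : s ≤ b <;> simp [h₁, h₂, mem_Ioc, not_le.1 h₁]
  have hu : ∀ t, ∫ s, T 0 t (G t s (g s)) =
      (∫ s, T 0 0 (G 0 s (g s))) + ∫ s in (0 : ℝ)..t, T 0 s (g s) := by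
    intro t
    rcases le_total 0 t with h | h
    · rw [← hdiff 0 t h]; abel
    · rw [intervalIntegral.integral_symm, ← hdiff t 0 h]; abel
  have heq : (fun t => ∫ s, G t s (g s)) = fun t =>
      T t 0 ((∫ s, T 0 0 (G 0 s (g s))) + ∫ s in (0 : ℝ)..t, T 0 s (g s)) := by
    funext t
    rw [← hu, (T 0 t).integral_comp_comm (hint t), hcomp, hone]
  have hderiv := (hT 0 t).clm_apply
    ((intervalIntegral.integral_hasDerivAt_right (hh.intervalIntegrable 0 t)
      hh.stronglyMeasurable.stronglyMeasurableAtFilter hh.continuousAt).const_add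
      (∫ s, T 0 0 (G 0 s (g s))))
  rw [hcomp, hone] at hderiv
  rw [show (∫ s, G t s (g s)) = _ from congrFun heq t, heq]
  exact hderiv

open BoundedContinuousFunction in
/-- A contractive Green kernel gives a unique bounded solution of the perturbed equation. -/
theorem existsUnique_bounded_solution (hA : Continuous A) (hTid : ∀ s, T s s = 1)
    (hT : ∀ s t, HasDerivAt (fun r => T r s) ((A t).comp (T t s)) t) (hP : Continuous P)
    (hG : ∀ t s, G t s = if s ≤ t then (T t s).comp (P s) else -((T t s).comp (1 - P s)))
    {F : ℝ → X → X} (hF : Continuous fun p : ℝ × X => F p.1 p.2)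
    {c : ℝ → ℝ} (hc0 : ∀ t, 0 ≤ c t) (hlip : ∀ t x₁ x₂, ‖F t x₁ - F t x₂‖ ≤ c t * ‖x₁ - x₂‖)
    {q : ℝ} (hq1 : q < 1) (hqint : ∀ t, Integrable (fun s => c s * ‖G t s‖))
    (hq : ∀ t, (∫ s, c s * ‖G t s‖) ≤ q)
    {eps : ℝ → ℝ} {L : ℝ} (hLint : ∀ t, Integrable (fun s => eps s * ‖G t s‖))
    (hL : ∀ t, (∫ s, eps s * ‖G t s‖) ≤ L)
    (hnb : ∀ x : ℝ → X, (∀ t, HasDerivAt x (A t (x t)) t) →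
      (∃ M, ∀ t, ‖x t‖ ≤ M) → ∀ t, x t = 0)
    (hF0 : ∀ t, ‖F t 0‖ ≤ eps t) :
    ∃! z : ℝ → X, (∀ t, HasDerivAt z (A t (z t) + F t (z t)) t) ∧ ∀ t, ‖z t‖ ≤ L / (1 - q) := by
  have hq0 : 0 ≤ q :=
    (integral_nonneg fun s => mul_nonneg (hc0 s) (norm_nonneg _)).trans (hq 0)
  have hFc : ∀ z : ℝ →ᵇ X, Continuous fun s => F s (z s) := fun z =>
    hF.comp (continuous_id.prodMk z.continuous)
  have hbound : ∀ (z : ℝ →ᵇ X) t s,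
      ‖G t s (F s (z s))‖ ≤ eps s * ‖G t s‖ + c s * ‖G t s‖ * ‖z‖ := by
    intro z t s
    have h₁ : ‖F s (z s)‖ ≤ eps s + c s * ‖z‖ :=
      calc ‖F s (z s)‖ ≤ ‖F s 0‖ + ‖F s (z s) - F s 0‖ := norm_le_norm_add_norm_sub' _ _
        _ ≤ eps s + c s * ‖z s - 0‖ := add_le_add (hF0 s) (hlip s _ _)
        _ ≤ eps s + c s * ‖z‖ := by
          rw [sub_zero]
          gcongr
          · exact hc0 s
          · exact z.norm_coe_le_norm s
    calc ‖G t s (F s (z s))‖ ≤ ‖G t s‖ * (eps s + c s * ‖z‖) := (G t s).le_opNorm_of_le h₁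
      _ = _ := by ring
  have hbi : ∀ (z : ℝ →ᵇ X) t,
      Integrable fun s => eps s * ‖G t s‖ + c s * ‖G t s‖ * ‖z‖ := fun z t =>
    (hLint t).add ((hqint t).mul_const _)
  have hint : ∀ (z : ℝ →ᵇ X) t, Integrable fun s => G t s (F s (z s)) := fun z t =>
    (hbi z t).mono' (aestronglyMeasurable_green_apply hA hTid hT hP hG (hFc z) t)
      (Filter.Eventually.of_forall (hbound z t))
  have hΦd : ∀ (z : ℝ →ᵇ X) t, HasDerivAt (fun t => ∫ s, G t s (F s (z s)))
      (A t (∫ s, G t s (F s (z s))) + F t (z t)) t := fun z =>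
    hasDerivAt_integral_green hA hTid hT hG (hFc z) (hint z)
  have hΦb : ∀ (z : ℝ →ᵇ X) t, ‖∫ s, G t s (F s (z s))‖ ≤ L + q * ‖z‖ := by
    intro z t
    refine (norm_integral_le_of_norm_le (hbi z t) (Filter.Eventually.of_forall (hbound z t))).trans ?_
    rw [integral_add (hLint t) ((hqint t).mul_const _), integral_mul_const]
    gcongr
    · exact hL t
    · exact hq t
  let Φ : (ℝ →ᵇ X) → ℝ →ᵇ X := fun z =>
    ofNormedAddCommGroup (fun t => ∫ s, G t s (F s (z s)))
      (continuous_iff_continuousAt.2 fun t => (hΦd z t).continuousAt) _ (hΦb z)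
  have hΦlip : LipschitzWith ⟨q, hq0⟩ Φ := by
    refine LipschitzWith.of_dist_le_mul fun z w => ?_
    refine (dist_le (mul_nonneg hq0 dist_nonneg)).2 fun t => ?_
    change dist (∫ s, G t s (F s (z s))) (∫ s, G t s (F s (w s))) ≤ q * dist z w
    rw [dist_eq_norm, ← integral_sub (hint z t) (hint w t)]
    refine (norm_integral_le_of_norm_le ((hqint t).mul_const (dist z w))
      (Filter.Eventually.of_forall fun s => ?_)).trans ?_
    · rw [← map_sub]
      have h₁ : ‖F s (z s) - F s (w s)‖ ≤ c s * dist z w :=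
        (hlip s _ _).trans (mul_le_mul_of_nonneg_left
          (by rw [← dist_eq_norm]; exact dist_coe_le_dist s) (hc0 s))
      exact ((G t s).le_opNorm_of_le h₁).trans (le_of_eq (by ring))
    · rw [integral_mul_const]
      exact mul_le_mul_of_nonneg_right (hq t) dist_nonneg
  have hΦ : ContractingWith ⟨q, hq0⟩ Φ := ⟨by exact_mod_cast hq1, hΦlip⟩
  have hfix := hΦ.fixedPoint_isFixedPt
  set z := ContractingWith.fixedPoint Φ hΦ
  have hzt : (fun t => ∫ s, G t s (F s (z s))) = z := congrArg DFunLike.coe hfix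
  refine ⟨z, ⟨fun t => ?_, fun t => ?_⟩, ?_⟩
  · have := hΦd z t
    rwa [show (∫ s, G t s (F s (z s))) = z t from congrFun hzt t, hzt] at this
  · refine (z.norm_coe_le_norm t).trans ?_
    have h₁ : ‖z‖ ≤ L + q * ‖z‖ := by
      refine z.norm_le_of_nonempty.2 fun t => ?_
      rw [← congrFun hzt t]
      exact hΦb z t
    rw [le_div_iff₀ (by linarith)]
    linarith
  · rintro w ⟨hwd, hwb⟩
    let w' : ℝ →ᵇ X := ofNormedAddCommGroup w
      (continuous_iff_continuousAt.2 fun t => (hwd t).continuousAt) _ hwb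
    have hw' : Function.IsFixedPt Φ w' := by
      ext t
      refine sub_eq_zero.1 (hnb (fun t => Φ w' t - w' t) (fun t => ?_)
        ⟨‖Φ w' - w'‖, (Φ w' - w').norm_coe_le_norm⟩ t)
      refine ((hΦd w' t).sub (hwd t)).congr_deriv ?_
      rw [map_sub]
      exact add_sub_add_right_eq_sub _ _ _
    exact congrArg DFunLike.coe (hΦ.fixedPoint_unique hw')

end Green

/-- Theorem PR, continuous time shadowing.
If the linear equation `x' = A(t)x` has no nonzero bounded solution, `q < 1` and `L < ∞`,
then every approximate solution `y_λ` of `x' = A(t)x + f_λ(t,x)` is shadowed by a unique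
exact solution `x_λ` with `sup_t ‖x_λ(t) − y_λ(t)‖ ≤ L/(1−q)`. -/
theorem stmt0
    {X : Type*} [NormedAddCommGroup X] [NormedSpace ℝ X] [CompleteSpace X]
    {E : Type*} [NormedAddCommGroup E] [NormedSpace ℝ E]
    -- the linear part and its evolution family
    (A : ℝ → X →L[ℝ] X) (hA : Continuous A)
    (T : ℝ → ℝ → X →L[ℝ] X)
    (hTid : ∀ s, T s s = 1)
    (hT : ∀ s t, HasDerivAt (fun r => T r s) ((A t).comp (T t s)) t)
    -- the projections and the Green function 𝒢
    (P : ℝ → X →L[ℝ] X) (hP : Continuous P)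
    (G : ℝ → ℝ → X →L[ℝ] X)
    (hG : ∀ t s, G t s = if s ≤ t then (T t s).comp (P s)
      else -((T t s).comp (1 - P s)))
    -- the parameter set Σ
    (Sg : Set E) (hSg : IsOpen Sg) (hSgne : Sg.Nonempty)
    -- the nonlinearity and its Lipschitz condition
    (f : E → ℝ → X → X)
    (hf : ∀ lam ∈ Sg, Continuous (fun p : ℝ × X => f lam p.1 p.2))
    (c : ℝ → ℝ) (hc : Continuous c) (hc0 : ∀ t, 0 ≤ c t)
    (hlip : ∀ lam ∈ Sg, ∀ t (x₁ x₂ : X),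
      ‖f lam t x₁ - f lam t x₂‖ ≤ c t * ‖x₁ - x₂‖)
    -- q := sup_t ∫ c(s)‖𝒢(t,s)‖ ds < 1
    (q : ℝ) (hq1 : q < 1)
    (hqint : ∀ t, Integrable (fun s => c s * ‖G t s‖))
    (hq : ∀ t, (∫ s, c s * ‖G t s‖) ≤ q)
    -- L := sup_t ∫ ε(s)‖𝒢(t,s)‖ ds < ∞
    (eps : ℝ → ℝ) (heps : Continuous eps) (heps0 : ∀ t, 0 < eps t)
    (L : ℝ)
    (hLint : ∀ t, Integrable (fun s => eps s * ‖G t s‖))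
    (hL : ∀ t, (∫ s, eps s * ‖G t s‖) ≤ L)
    -- the linear equation has no nonzero bounded solution
    (hnb : ∀ x : ℝ → X, (∀ t, HasDerivAt x (A t (x t)) t) →
      (∃ M, ∀ t, ‖x t‖ ≤ M) → ∀ t, x t = 0)
    -- the approximate solutions y_λ (continuously differentiable)
    (y : E → ℝ → X) (y' : E → ℝ → X)
    (hy : ∀ lam ∈ Sg, ∀ t, HasDerivAt (y lam) (y' lam t) t)
    (hy' : ∀ lam ∈ Sg, Continuous (y' lam))
    (hpse : ∀ lam ∈ Sg, ∀ t,
      ‖y' lam t - A t (y lam t) - f lam t (y lam t)‖ ≤ eps t) :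
    -- conclusion: unique shadowing solution
    ∀ lam ∈ Sg, ∃! x : ℝ → X,
      (∀ t, HasDerivAt x (A t (x t) + f lam t (x t)) t) ∧
      ∀ t, ‖x t - y lam t‖ ≤ L / (1 - q) := by
  intro lam hlam
  have hyc : Continuous (y lam) := continuous_iff_continuousAt.2 fun t => (hy lam hlam t).continuousAt
  have hfc := hf lam hlam
  have hyc' := hy' lam hlam
  obtain ⟨z, ⟨hzd, hzb⟩, hzu⟩ := existsUnique_bounded_solution hA hTid hT hP hG
    (F := fun t v => f lam t (y lam t + v) + A t (y lam t) - y' lam t)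
    (by
      have h₁ : Continuous fun p : ℝ × X => f lam p.1 (y lam p.1 + p.2) :=
        hfc.comp (f := fun p : ℝ × X => (p.1, y lam p.1 + p.2)) (by fun_prop)
      fun_prop)
    hc0 (fun t v w => by simpa using hlip lam hlam t (y lam t + v) (y lam t + w))
    hq1 hqint hq hLint hL hnb
    (fun t => by
      refine le_of_eq_of_le ?_ (hpse lam hlam t)
      rw [← norm_neg, add_zero]
      congr 1
      abel)
  refine ⟨fun t => y lam t + z t, ⟨fun t => ?_, fun t => by simpa using hzb t⟩, ?_⟩
  · refine ((hy lam hlam t).add (hzd t)).congr_deriv ?_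
    rw [map_add]
    abel
  · rintro x ⟨hxd, hxb⟩
    have hx := hzu (fun t => x t - y lam t) ⟨fun t => ?_, hxb⟩
    · funext t
      rw [← hx, add_sub_cancel]
    · refine ((hxd t).sub (hy lam hlam t)).congr_deriv ?_
      rw [map_sub, add_sub_cancel]
      abel
end

section
/- Assume q < 1 and L < ∞, and for λ ∈ Σ let y_λ : ℝ → X be continuously differentiable with |y_λ'(t) − A(t)y_λ(t) − f_λ(t, y_λ(t))| ≤ ε(t) for all t ∈ ℝ. Define (𝒯_λ z)(t) := ∫_ℝ 𝒢(t,s)(A(s)y_λ(s) + f_λ(s, y_λ(s)+z(s)) − y_λ'(s)) ds for z ∈ 𝒴. Then: (i) 𝒯_λ maps 𝒴 into 𝒴 and ‖𝒯_λ z‖∞ ≤ L + q‖z‖∞ for every z ∈ 𝒴; (ii) ‖𝒯_λ z₁ − 𝒯_λ z₂‖∞ ≤ q‖z₁ − z₂‖∞ for all z₁, z₂ ∈ 𝒴; (iii) consequently 𝒯_λ maps the closed ball 𝒟 := {z ∈ 𝒴 : ‖z‖∞ ≤ L/(1−q)} into itself. -/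
open MeasureTheory Set

/-- Two solutions of the linear equation `x' = A(t) x` that agree at one time are equal. -/
theorem linearODE_solution_unique {Y : Type*} [NormedAddCommGroup Y] [NormedSpace ℝ Y]
    {B : ℝ → Y →L[ℝ] Y} (hB : Continuous B) {u v : ℝ → Y} {r : ℝ}
    (hu : ∀ t, HasDerivAt u (B t (u t)) t) (hv : ∀ t, HasDerivAt v (B t (v t)) t)
    (huv : u r = v r) : u = v := by
  funext t
  obtain ⟨a, ha⟩ := exists_lt (min r t)
  obtain ⟨b, hb⟩ := exists_gt (max r t)
  rw [lt_min_iff] at ha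
  rw [max_lt_iff] at hb
  obtain ⟨K, hK⟩ := isCompact_Icc.exists_bound_of_continuousOn (s := Icc a b) hB.continuousOn
  have hlip : ∀ s ∈ Ioo a b, LipschitzOnWith K.toNNReal (fun x => B s x) univ := by
    intro s hs
    refine ((B s).lipschitz.weaken ?_).lipschitzOnWith
    exact NNReal.le_toNNReal_of_coe_le (hK s (Ioo_subset_Icc_self hs))
  exact ODE_solution_unique_of_mem_Icc (v := fun s x => B s x) (s := fun _ => univ) hlip
    ⟨ha.1, hb.1⟩ (fun s _ => (hu s).continuousAt.continuousWithinAt) (fun s _ => hu s)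
    (fun _ _ => mem_univ _) (fun s _ => (hv s).continuousAt.continuousWithinAt) (fun s _ => hv s)
    (fun _ _ => mem_univ _) huv ⟨ha.2.le, hb.2.le⟩

section EvolutionFamily

variable {X : Type*} [NormedAddCommGroup X] [NormedSpace ℝ X]
  {A : ℝ → X →L[ℝ] X} {T : ℝ → ℝ → X →L[ℝ] X}

theorem evolutionFamily_comp (hA : Continuous A) (hTid : ∀ s, T s s = 1)
    (hT : ∀ s t, HasDerivAt (fun r => T r s) ((A t).comp (T t s)) t) (t r s : ℝ) :
    T t s = (T t r).comp (T r s) := by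
  have hB : Continuous fun t => ContinuousLinearMap.compL ℝ X X X (A t) :=
    (ContinuousLinearMap.compL ℝ X X X).continuous.comp hA
  refine congrFun (linearODE_solution_unique (r := r) hB (u := fun t => T t s)
    (v := fun t => (T t r).comp (T r s)) (fun t => hT s t) (fun t => ?_) ?_) t
  · simpa [Function.comp_def, ContinuousLinearMap.comp_assoc] using
      ((ContinuousLinearMap.compL ℝ X X X).flip (T r s)).hasFDerivAt.comp_hasDerivAt t (hT r t)
  · ext x
    simp [hTid]

theorem continuous_evolutionFamily_right [CompleteSpace X] (hA : Continuous A)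
    (hTid : ∀ s, T s s = 1)
    (hT : ∀ s t, HasDerivAt (fun r => T r s) ((A t).comp (T t s)) t) (t : ℝ) :
    Continuous fun s => T t s := by
  have hmul : ∀ s r, T s r * T r s = 1 := fun s r => by
    rw [← hTid s, evolutionFamily_comp hA hTid hT s r s]; rfl
  have hinv : (fun s => T t s) = fun s => Ring.inverse (T s t) := by
    funext s
    exact (Ring.inverse_unit ⟨T s t, T t s, hmul s t, hmul t s⟩).symm
  rw [hinv, continuous_iff_continuousAt]
  intro s
  exact ContinuousAt.comp (f := fun s => T s t)
    (NormedRing.inverse_continuousAt ⟨T s t, T t s, hmul s t, hmul t s⟩) (hT t s).continuousAt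

end EvolutionFamily

section GreenKernel

variable {X : Type*} [NormedAddCommGroup X] [NormedSpace ℝ X]
  {A : ℝ → X →L[ℝ] X} {T : ℝ → ℝ → X →L[ℝ] X} {P : ℝ → X →L[ℝ] X}
  {G : ℝ → ℝ → X →L[ℝ] X} {h : ℝ → X}

theorem aestronglyMeasurable_greenKernel_apply [CompleteSpace X] (hA : Continuous A)
    (hTid : ∀ s, T s s = 1)
    (hT : ∀ s t, HasDerivAt (fun r => T r s) ((A t).comp (T t s)) t) (hP : Continuous P)
    (hG : ∀ t s, G t s = if s ≤ t then (T t s).comp (P s) else -((T t s).comp (1 - P s)))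
    (hh : Continuous h) (t : ℝ) : AEStronglyMeasurable (fun s => G t s (h s)) := by
  have hTc := continuous_evolutionFamily_right hA hTid hT t
  have heq : (fun s => G t s (h s)) = fun s =>
      if s ≤ t then T t s (P s (h s)) else -(T t s (h s - P s (h s))) := by
    funext s
    rw [hG]
    split_ifs <;> simp
  rw [heq]
  refine (StronglyMeasurable.ite measurableSet_Iic (Continuous.stronglyMeasurable ?_)
    (Continuous.stronglyMeasurable ?_)).aestronglyMeasurable
  · exact hTc.clm_apply (hP.clm_apply hh)
  · exact (hTc.clm_apply (hh.sub (hP.clm_apply hh))).neg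

/-- Variation of constants for the integral of `h` against the Green kernel. -/
theorem integral_greenKernel_eq [CompleteSpace X] (hA : Continuous A)
    (hTid : ∀ s, T s s = 1)
    (hT : ∀ s t, HasDerivAt (fun r => T r s) ((A t).comp (T t s)) t)
    (hG : ∀ t s, G t s = if s ≤ t then (T t s).comp (P s) else -((T t s).comp (1 - P s)))
    (hh : Continuous h) (hint : ∀ t, Integrable fun s => G t s (h s)) (r t : ℝ) :
    ∫ s, G t s (h s) = T t r ((∫ s, G r s (h s)) + ∫ s in r..t, T r s (h s)) := by
  have hTh : Continuous fun s => T r s (h s) :=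
    (continuous_evolutionFamily_right hA hTid hT r).clm_apply hh
  have hI₁ : Integrable (indicator (Ioc r t) fun s => T r s (h s)) :=
    (integrable_indicator_iff measurableSet_Ioc).2
      (hTh.integrableOn_Icc.mono_set Ioc_subset_Icc_self)
  have hI₂ : Integrable (indicator (Ioc t r) fun s => T r s (h s)) :=
    (integrable_indicator_iff measurableSet_Ioc).2
      (hTh.integrableOn_Icc.mono_set Ioc_subset_Icc_self)
  have hI : Integrable fun s => indicator (Ioc r t) (fun s => T r s (h s)) s -
      indicator (Ioc t r) (fun s => T r s (h s)) s := hI₁.sub hI₂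
  have hsum : Integrable fun s => G r s (h s) + (indicator (Ioc r t) (fun s => T r s (h s)) s -
      indicator (Ioc t r) (fun s => T r s (h s)) s) := (hint r).add hI
  rw [intervalIntegral, ← integral_indicator measurableSet_Ioc,
    ← integral_indicator measurableSet_Ioc, ← integral_sub hI₁ hI₂,
    ← integral_add (hint r) hI,
    ← ContinuousLinearMap.integral_comp_comm _ hsum]
  congr 1
  funext s
  have hcomp : ∀ x, T t s x = T t r (T r s x) := fun x => by
    rw [evolutionFamily_comp hA hTid hT t r s]; rfl
  rw [hG, hG]
  by_cases h₁ : s ≤ t <;> by_cases h₂ : s ≤ r <;>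
    simp [indicator, h₁, h₂, hcomp, not_lt.2, not_le.1, sub_eq_add_neg]

theorem continuous_integral_greenKernel [CompleteSpace X] (hA : Continuous A)
    (hTid : ∀ s, T s s = 1)
    (hT : ∀ s t, HasDerivAt (fun r => T r s) ((A t).comp (T t s)) t)
    (hG : ∀ t s, G t s = if s ≤ t then (T t s).comp (P s) else -((T t s).comp (1 - P s)))
    (hh : Continuous h) (hint : ∀ t, Integrable fun s => G t s (h s)) :
    Continuous fun t => ∫ s, G t s (h s) := by
  have hTh : Continuous fun s => T 0 s (h s) :=
    (continuous_evolutionFamily_right hA hTid hT 0).clm_apply hh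
  rw [funext (integral_greenKernel_eq hA hTid hT hG hh hint 0)]
  refine Continuous.clm_apply
    (continuous_iff_continuousAt.2 fun t => (hT 0 t).continuousAt) (continuous_const.add ?_)
  exact intervalIntegral.continuous_primitive (fun a b => hTh.intervalIntegrable a b) 0

end GreenKernel

/-- properties of the operator
`(𝒯_λ z)(t) = ∫ 𝒢(t,s)(A(s)y_λ(s) + f_λ(s, y_λ(s)+z(s)) − y_λ'(s)) ds` on the space
`𝒴` of bounded continuous functions: (i) it maps `𝒴` into `𝒴` with
`‖𝒯_λ z‖∞ ≤ L + q‖z‖∞`; (ii) it is a `q`-contraction; (iii) it maps the closed ball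
of radius `L/(1−q)` into itself. -/
theorem stmt1
    {X : Type*} [NormedAddCommGroup X] [NormedSpace ℝ X] [CompleteSpace X]
    {E : Type*} [NormedAddCommGroup E] [NormedSpace ℝ E]
    (A : ℝ → X →L[ℝ] X) (hA : Continuous A)
    (T : ℝ → ℝ → X →L[ℝ] X)
    (hTid : ∀ s, T s s = 1)
    (hT : ∀ s t, HasDerivAt (fun r => T r s) ((A t).comp (T t s)) t)
    (P : ℝ → X →L[ℝ] X) (hP : Continuous P)
    (G : ℝ → ℝ → X →L[ℝ] X)
    (hG : ∀ t s, G t s = if s ≤ t then (T t s).comp (P s)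
      else -((T t s).comp (1 - P s)))
    (Sg : Set E) (hSg : IsOpen Sg) (hSgne : Sg.Nonempty)
    (f : E → ℝ → X → X)
    (hf : ∀ lam ∈ Sg, Continuous (fun p : ℝ × X => f lam p.1 p.2))
    (c : ℝ → ℝ) (hc : Continuous c) (hc0 : ∀ t, 0 ≤ c t)
    (hlip : ∀ lam ∈ Sg, ∀ t (x₁ x₂ : X),
      ‖f lam t x₁ - f lam t x₂‖ ≤ c t * ‖x₁ - x₂‖)
    (q : ℝ) (hq1 : q < 1)
    (hqint : ∀ t, Integrable (fun s => c s * ‖G t s‖))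
    (hq : ∀ t, (∫ s, c s * ‖G t s‖) ≤ q)
    (eps : ℝ → ℝ) (heps : Continuous eps) (heps0 : ∀ t, 0 < eps t)
    (L : ℝ)
    (hLint : ∀ t, Integrable (fun s => eps s * ‖G t s‖))
    (hL : ∀ t, (∫ s, eps s * ‖G t s‖) ≤ L)
    (y : E → ℝ → X) (y' : E → ℝ → X)
    (hy : ∀ lam ∈ Sg, ∀ t, HasDerivAt (y lam) (y' lam t) t)
    (hy' : ∀ lam ∈ Sg, Continuous (y' lam))
    (hpse : ∀ lam ∈ Sg, ∀ t,
      ‖y' lam t - A t (y lam t) - f lam t (y lam t)‖ ≤ eps t)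
    -- the operator 𝒯_λ
    (Top : E → BoundedContinuousFunction ℝ X → ℝ → X)
    (hTop : ∀ lam ∈ Sg, ∀ (z : BoundedContinuousFunction ℝ X) (t : ℝ),
      Top lam z t =
        ∫ s, G t s (A s (y lam s) + f lam s (y lam s + z s) - y' lam s)) :
    ∀ lam ∈ Sg,
      -- (i) 𝒯_λ maps 𝒴 into 𝒴, with ‖𝒯_λ z‖∞ ≤ L + q‖z‖∞
      (∀ z : BoundedContinuousFunction ℝ X,
        Continuous (Top lam z) ∧ ∀ t, ‖Top lam z t‖ ≤ L + q * ‖z‖) ∧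
      -- (ii) contraction: ‖𝒯_λ z₁ − 𝒯_λ z₂‖∞ ≤ q‖z₁ − z₂‖∞
      (∀ z₁ z₂ : BoundedContinuousFunction ℝ X, ∀ t,
        ‖Top lam z₁ t - Top lam z₂ t‖ ≤ q * ‖z₁ - z₂‖) ∧
      -- (iii) 𝒯_λ maps the ball 𝒟 = {‖z‖∞ ≤ L/(1−q)} into itself
      (∀ z : BoundedContinuousFunction ℝ X, ‖z‖ ≤ L / (1 - q) →
        ∀ t, ‖Top lam z t‖ ≤ L / (1 - q)) := by
  intro lam hlam
  have hyc : Continuous (y lam) :=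
    continuous_iff_continuousAt.2 fun t => (hy lam hlam t).continuousAt
  have hq0 : 0 ≤ q :=
    (integral_nonneg fun s => mul_nonneg (hc0 s) (norm_nonneg _)).trans (hq 0)
  have hcont : ∀ z : BoundedContinuousFunction ℝ X, Continuous fun s =>
      A s (y lam s) + f lam s (y lam s + z s) - y' lam s := fun z =>
    ((hA.clm_apply hyc).add ((hf lam hlam).comp
      (continuous_id.prodMk (hyc.add z.continuous)))).sub (hy' lam hlam)
  have hbound : ∀ (z : BoundedContinuousFunction ℝ X) (t s : ℝ),
      ‖G t s (A s (y lam s) + f lam s (y lam s + z s) - y' lam s)‖ ≤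
        eps s * ‖G t s‖ + (c s * ‖G t s‖) * ‖z‖ := by
    intro z t s
    have h₁ : ‖f lam s (y lam s + z s) - f lam s (y lam s)‖ ≤ c s * ‖z‖ := by
      refine (hlip lam hlam s _ _).trans ?_
      rw [add_sub_cancel_left]
      exact mul_le_mul_of_nonneg_left (z.norm_coe_le_norm s) (hc0 s)
    have h₂ : ‖A s (y lam s) + f lam s (y lam s + z s) - y' lam s‖ ≤ eps s + c s * ‖z‖ := by
      have heq : A s (y lam s) + f lam s (y lam s + z s) - y' lam s =
          (f lam s (y lam s + z s) - f lam s (y lam s)) -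
            (y' lam s - A s (y lam s) - f lam s (y lam s)) := by abel
      rw [heq]
      linarith [norm_sub_le (f lam s (y lam s + z s) - f lam s (y lam s))
        (y' lam s - A s (y lam s) - f lam s (y lam s)), hpse lam hlam s]
    calc _ ≤ ‖G t s‖ * (eps s + c s * ‖z‖) := (G t s).le_opNorm_of_le h₂
      _ = _ := by ring
  have hmaj : ∀ (z : BoundedContinuousFunction ℝ X) (t : ℝ),
      Integrable fun s => eps s * ‖G t s‖ + (c s * ‖G t s‖) * ‖z‖ := fun z t =>
    (hLint t).add ((hqint t).mul_const _)
  have hint : ∀ (z : BoundedContinuousFunction ℝ X) (t : ℝ), Integrable fun s =>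
      G t s (A s (y lam s) + f lam s (y lam s + z s) - y' lam s) := fun z t =>
    (hmaj z t).mono' (aestronglyMeasurable_greenKernel_apply hA hTid hT hP hG (hcont z) t)
      (Filter.Eventually.of_forall (hbound z t))
  have hnorm : ∀ (z : BoundedContinuousFunction ℝ X) (t : ℝ),
      ‖Top lam z t‖ ≤ L + q * ‖z‖ := by
    intro z t
    rw [hTop lam hlam]
    refine (norm_integral_le_of_norm_le (hmaj z t)
      (Filter.Eventually.of_forall (hbound z t))).trans ?_
    rw [integral_add (hLint t) ((hqint t).mul_const _), integral_mul_const]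
    exact add_le_add (hL t) (mul_le_mul_of_nonneg_right (hq t) (norm_nonneg z))
  refine ⟨fun z => ⟨?_, hnorm z⟩, fun z₁ z₂ t => ?_, fun z hz t => (hnorm z t).trans ?_⟩
  · rw [funext (hTop lam hlam z)]
    exact continuous_integral_greenKernel hA hTid hT hG (hcont z) (hint z)
  · rw [hTop lam hlam, hTop lam hlam, ← integral_sub (hint z₁ t) (hint z₂ t)]
    refine (norm_integral_le_of_norm_le ((hqint t).mul_const ‖z₁ - z₂‖)
      (Filter.Eventually.of_forall fun s => ?_)).trans ?_
    · have hf₁₂ : ‖f lam s (y lam s + z₁ s) - f lam s (y lam s + z₂ s)‖ ≤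
          c s * ‖z₁ - z₂‖ := by
        refine (hlip lam hlam s _ _).trans ?_
        rw [add_sub_add_left_eq_sub]
        exact mul_le_mul_of_nonneg_left ((z₁ - z₂).norm_coe_le_norm s) (hc0 s)
      rw [← map_sub, sub_sub_sub_cancel_right, add_sub_add_left_eq_sub]
      calc _ ≤ ‖G t s‖ * (c s * ‖z₁ - z₂‖) := (G t s).le_opNorm_of_le hf₁₂
        _ = _ := by ring
    · rw [integral_mul_const]
      exact mul_le_mul_of_nonneg_right (hq t) (norm_nonneg _)
  · have h1q : 0 < 1 - q := sub_pos.2 hq1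
    calc L + q * ‖z‖ ≤ L + q * (L / (1 - q)) := by gcongr
      _ = L / (1 - q) := by field_simp; ring
end

section
/- Assume the linear equation x' = A(t)x has no nonzero bounded solution, q < 1 and L < ∞; for each λ ∈ Σ let y_λ : ℝ → X be continuously differentiable with |y_λ'(t) − A(t)y_λ(t) − f_λ(t, y_λ(t))| ≤ ε(t) for all t ∈ ℝ, and let x_λ : ℝ → X be the unique solution of x' = A(t)x + f_λ(t,x) with sup_{t∈ℝ}|x_λ(t) − y_λ(t)| ≤ L/(1−q). Let k ∈ ℕ and suppose there exists C > 0 such that conditions (R1) and (R2) hold. Then for each t ∈ ℝ the map Σ ∋ λ ↦ x_λ(t) is C^k. -/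
open MeasureTheory Set

open scoped BoundedContinuousFunction ContDiff Topology

section EvolutionFamily

/-- Two solutions of a linear equation `u' = B(t) u` which agree at one time agree everywhere. -/
theorem linearODE_unique {F : Type*} [NormedAddCommGroup F] [NormedSpace ℝ F]
    {B : ℝ → F →L[ℝ] F} (hB : Continuous B) {u v : ℝ → F}
    (hu : ∀ t, HasDerivAt u (B t (u t)) t) (hv : ∀ t, HasDerivAt v (B t (v t)) t)
    {t₀ : ℝ} (h₀ : u t₀ = v t₀) (t : ℝ) : u t = v t := by
  set a := min t t₀ - 1 with ha
  set b := max t t₀ + 1 with hb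
  have hmem : ∀ r, min t t₀ ≤ r → r ≤ max t t₀ → r ∈ Ioo a b :=
    fun r h1 h2 => ⟨by linarith, by linarith⟩
  obtain ⟨K, hK⟩ := (isCompact_Icc (a := a) (b := b)).exists_bound_of_continuousOn hB.continuousOn
  have hlip : ∀ r ∈ Ioo a b, LipschitzOnWith K.toNNReal (fun w => B r w) univ := by
    intro r hr
    refine LipschitzOnWith.of_dist_le_mul fun x _ y _ => ?_
    rw [dist_eq_norm, dist_eq_norm, ← map_sub]
    refine (B r).le_of_opNorm_le ((hK r (Ioo_subset_Icc_self hr)).trans ?_) _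
    exact Real.le_coe_toNNReal K
  exact ODE_solution_unique_of_mem_Ioo (s := fun _ => univ) hlip
    (hmem t₀ (min_le_right _ _) (le_max_right _ _)) (fun r _ => ⟨hu r, mem_univ _⟩)
    (fun r _ => ⟨hv r, mem_univ _⟩) h₀ (hmem t (min_le_left _ _) (le_max_left _ _))

/-- `T` is the evolution family of the linear equation `x' = A(t) x`. -/
structure IsEvolutionFamily {X : Type*} [NormedAddCommGroup X] [NormedSpace ℝ X]
    (A : ℝ → X →L[ℝ] X) (T : ℝ → ℝ → X →L[ℝ] X) : Prop where
  continuous_coeff : Continuous A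
  self_eq : ∀ s, T s s = 1
  hasDerivAt : ∀ s t, HasDerivAt (fun r => T r s) ((A t).comp (T t s)) t

namespace IsEvolutionFamily

variable {X : Type*} [NormedAddCommGroup X] [NormedSpace ℝ X]
  {A : ℝ → X →L[ℝ] X} {T : ℝ → ℝ → X →L[ℝ] X}

theorem comp_eq (h : IsEvolutionFamily A T) (t r s : ℝ) : (T t r).comp (T r s) = T t s := by
  have hB : Continuous fun t => ContinuousLinearMap.compL ℝ X X X (A t) :=
    (ContinuousLinearMap.compL ℝ X X X).continuous.comp h.continuous_coeff
  refine linearODE_unique hB (u := fun t => (T t r).comp (T r s)) (v := fun t => T t s)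
    (t₀ := r) (fun t => ?_) (fun t => h.hasDerivAt s t) ?_ t
  · have := (h.hasDerivAt r t).clm_comp (hasDerivAt_const t (T r s))
    simpa [ContinuousLinearMap.comp_assoc] using this
  · simp only [h.self_eq]; rfl

theorem continuous_left (h : IsEvolutionFamily A T) (s : ℝ) : Continuous fun t => T t s :=
  continuous_iff_continuousAt.2 fun t => (h.hasDerivAt s t).continuousAt

theorem continuous_right [CompleteSpace X] (h : IsEvolutionFamily A T) (t : ℝ) :
    Continuous fun s => T t s := by
  have hu : ∀ s r, T s r * T r s = 1 := fun s r => (h.comp_eq s r s).trans (h.self_eq s)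
  have heq : (fun s => T t s) = fun s => Ring.inverse (T s t) := by
    funext s
    exact (Ring.inverse_unit ⟨T s t, T t s, hu s t, hu t s⟩).symm
  rw [heq]
  refine continuous_iff_continuousAt.2 fun s => ?_
  exact ContinuousAt.comp (g := Ring.inverse) (f := fun s => T s t)
    (NormedRing.inverse_continuousAt ⟨T s t, T t s, hu s t, hu t s⟩)
    (h.continuous_left t).continuousAt

end IsEvolutionFamily

end EvolutionFamily

section Green

variable {X : Type*} [NormedAddCommGroup X] [NormedSpace ℝ X]
  {A : ℝ → X →L[ℝ] X} {T : ℝ → ℝ → X →L[ℝ] X} {P : ℝ → X →L[ℝ] X} {G : ℝ → ℝ → X →L[ℝ] X}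

/-- `G` is the Green function built from the evolution family `T` and the operators `P`. -/
def IsGreenFunction (T : ℝ → ℝ → X →L[ℝ] X) (P : ℝ → X →L[ℝ] X) (G : ℝ → ℝ → X →L[ℝ] X) : Prop :=
  ∀ t s, G t s = if s ≤ t then (T t s).comp (P s) else -((T t s).comp (1 - P s))

theorem IsGreenFunction.stronglyMeasurable [CompleteSpace X] (hT : IsEvolutionFamily A T)
    (hP : Continuous P) (hG : IsGreenFunction T P G) (t : ℝ) : StronglyMeasurable (G t) := by
  have hTc := hT.continuous_right t
  have : G t = (Iic t).piecewise (fun s => (T t s).comp (P s))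
      (fun s => -((T t s).comp (1 - P s))) := by
    funext s
    rw [hG t s]
    by_cases hs : s ≤ t <;> simp [hs]
  rw [this]
  exact StronglyMeasurable.piecewise measurableSet_Iic (hTc.clm_comp hP).stronglyMeasurable
    (hTc.clm_comp (continuous_const.sub hP)).neg.stronglyMeasurable

theorem IsGreenFunction.stronglyMeasurable_apply [CompleteSpace X] (hT : IsEvolutionFamily A T)
    (hP : Continuous P) (hG : IsGreenFunction T P G) (t : ℝ) {h : ℝ → X}
    (hh : StronglyMeasurable h) : StronglyMeasurable fun s => G t s (h s) :=
  (isBoundedBilinearMap_apply (𝕜 := ℝ) (E := X) (F := X)).continuous.comp_stronglyMeasurable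
    ((hG.stronglyMeasurable hT hP t).prodMk hh)

theorem IsGreenFunction.integrable_apply [CompleteSpace X] (hT : IsEvolutionFamily A T)
    (hP : Continuous P) (hG : IsGreenFunction T P G) {t : ℝ} {h : ℝ → X}
    (hh : StronglyMeasurable h) {b : ℝ → ℝ} (hb : Integrable fun s => b s * ‖G t s‖)
    (hhb : ∀ s, ‖h s‖ ≤ b s) : Integrable fun s => G t s (h s) := by
  refine hb.mono' (hG.stronglyMeasurable_apply hT hP t hh).aestronglyMeasurable
    (Filter.Eventually.of_forall fun s => ?_)
  rw [mul_comm]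
  exact (G t s).le_opNorm_of_le (hhb s)

theorem norm_integral_green_le {t : ℝ} {h : ℝ → X} {b : ℝ → ℝ}
    (hb : Integrable fun s => b s * ‖G t s‖) (hhb : ∀ s, ‖h s‖ ≤ b s) :
    ‖∫ s, G t s (h s)‖ ≤ ∫ s, b s * ‖G t s‖ := by
  refine norm_integral_le_of_norm_le hb (Filter.Eventually.of_forall fun s => ?_)
  rw [mul_comm]
  exact (G t s).le_opNorm_of_le (hhb s)

/-- Variation of constants for the integral against the Green function. -/
theorem IsGreenFunction.integral_eq [CompleteSpace X] (hT : IsEvolutionFamily A T)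
    (hG : IsGreenFunction T P G) {h : ℝ → X}
    (hloc : ∀ a b, IntervalIntegrable (fun s => T 0 s (h s)) volume a b)
    (h0 : Integrable fun s => G 0 s (h s)) (t : ℝ) :
    ∫ s, G t s (h s) = T t 0 ((∫ s, G 0 s (h s)) + ∫ s in (0 : ℝ)..t, T 0 s (h s)) := by
  have hpt : ∀ s, G t s (h s) = T t 0 (G 0 s (h s) + ((Ioc 0 t).indicator (fun s => T 0 s (h s)) s
      - (Ioc t 0).indicator (fun s => T 0 s (h s)) s)) := by
    intro s
    have hc : T t s = (T t 0).comp (T 0 s) := (hT.comp_eq t 0 s).symm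
    rw [hG t s, hG 0 s, hc]
    by_cases h1 : s ≤ t <;> by_cases h2 : s ≤ 0 <;>
      (simp [h1, h2, indicator, not_lt.2, not_le.1, ← map_sub, ← map_neg, ← map_add]; try grind)
  have i1 : Integrable ((Ioc 0 t).indicator fun s => T 0 s (h s)) :=
    (integrable_indicator_iff measurableSet_Ioc).2 (hloc 0 t).1
  have i2 : Integrable ((Ioc t 0).indicator fun s => T 0 s (h s)) :=
    (integrable_indicator_iff measurableSet_Ioc).2 (hloc 0 t).2
  simp_rw [hpt]
  have i12 := i1.sub i2
  refine (ContinuousLinearMap.integral_comp_comm (T t 0) (h0.add i12)).trans (congrArg _ ?_)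
  refine (integral_add h0 i12).trans (congrArg _ ?_)
  refine (integral_sub i1 i2).trans ?_
  rw [integral_indicator measurableSet_Ioc, integral_indicator measurableSet_Ioc]
  rfl

theorem IsGreenFunction.continuous_integral [CompleteSpace X] (hT : IsEvolutionFamily A T)
    (hG : IsGreenFunction T P G) {h : ℝ → X}
    (hloc : ∀ a b, IntervalIntegrable (fun s => T 0 s (h s)) volume a b)
    (h0 : Integrable fun s => G 0 s (h s)) : Continuous fun t => ∫ s, G t s (h s) := by
  rw [funext (hG.integral_eq hT hloc h0)]
  exact (hT.continuous_left 0).clm_apply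
    (continuous_const.add (intervalIntegral.continuous_primitive hloc 0))

theorem IsGreenFunction.hasDerivAt_integral [CompleteSpace X] (hT : IsEvolutionFamily A T)
    (hG : IsGreenFunction T P G) {h : ℝ → X} (hh : Continuous h)
    (h0 : Integrable fun s => G 0 s (h s)) (t : ℝ) :
    HasDerivAt (fun t => ∫ s, G t s (h s)) (A t (∫ s, G t s (h s)) + h t) t := by
  have hc : Continuous fun s => T 0 s (h s) := (hT.continuous_right 0).clm_apply hh
  have heq := hG.integral_eq hT (fun a b => hc.intervalIntegrable a b) h0
  have hd : HasDerivAt (fun t => (∫ s, G 0 s (h s)) + ∫ s in (0 : ℝ)..t, T 0 s (h s))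
      (T 0 t (h t)) t := (hc.integral_hasStrictDerivAt 0 t).hasDerivAt.const_add _
  have := (hT.hasDerivAt 0 t).clm_apply hd
  have hid : T t 0 (T 0 t (h t)) = h t := by
    have := hT.comp_eq t 0 t
    rw [hT.self_eq] at this
    exact congrArg (fun S : X →L[ℝ] X => S (h t)) this
  rw [hid] at this
  rw [heq t, funext heq]
  exact this

end Green

section WeightedSpace

variable {S : Type*} [MeasurableSpace S]

/-- The strongly measurable functions that are bounded by a multiple of the weight `m`. -/
def weightedBounded (X : Type*) [NormedAddCommGroup X] [NormedSpace ℝ X] (m : S → ℝ) :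
    Submodule ℝ (S → X) where
  carrier := {h | StronglyMeasurable h ∧ ∃ K, ∀ s, ‖h s‖ ≤ K * m s}
  add_mem' := by
    rintro a b ⟨ha, K, hK⟩ ⟨hb, K', hK'⟩
    refine ⟨ha.add hb, K + K', fun s => (norm_add_le _ _).trans ?_⟩
    rw [add_mul]
    exact add_le_add (hK s) (hK' s)
  zero_mem' := ⟨stronglyMeasurable_zero, 0, by simp⟩
  smul_mem' := by
    rintro r a ⟨ha, K, hK⟩
    refine ⟨ha.const_smul r, ‖r‖ * K, fun s => ?_⟩
    rw [Pi.smul_apply, norm_smul, mul_assoc]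
    exact mul_le_mul_of_nonneg_left (hK s) (norm_nonneg r)

variable {V : Type*} [NormedAddCommGroup V] [NormedSpace ℝ V]
  {X : Type*} [NormedAddCommGroup X] [NormedSpace ℝ X]
  {Y : Type*} [NormedAddCommGroup Y] [NormedSpace ℝ Y]

theorem hasFDerivWithinAt_iteratedFDerivWithin {f : V → X} {W : Set V} {n i : ℕ}
    (hf : ContDiffOn ℝ n f W) (hW : IsOpen W) (hi : i < n) {v : V} (hv : v ∈ W) :
    HasFDerivWithinAt (iteratedFDerivWithin ℝ i f W)
      (iteratedFDerivWithin ℝ (i + 1) f W v).curryLeft W v :=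
  (hf.ftaylorSeriesWithin hW.uniqueDiffOn).fderivWithin i (by exact_mod_cast hi) v hv

theorem norm_iteratedFDerivWithin_sub_le {f : V → X} {W : Set V} {n i : ℕ}
    (hf : ContDiffOn ℝ n f W) (hW : IsOpen W) (hWc : Convex ℝ W) (hi : i < n) {K : ℝ}
    (hK : ∀ v ∈ W, ‖iteratedFDerivWithin ℝ (i + 1) f W v‖ ≤ K) {v w : V} (hv : v ∈ W)
    (hw : w ∈ W) :
    ‖iteratedFDerivWithin ℝ i f W w - iteratedFDerivWithin ℝ i f W v‖ ≤ K * ‖w - v‖ := by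
  refine hWc.norm_image_sub_le_of_norm_hasFDerivWithin_le
    (fun u hu => hasFDerivWithinAt_iteratedFDerivWithin hf hW hi hu) (fun u hu => ?_) hv hw
  rw [ContinuousMultilinearMap.curryLeft_norm]
  exact hK u hu

theorem norm_iteratedFDerivWithin_sub_sub_le {f : V → X} {W : Set V} {n i : ℕ}
    (hf : ContDiffOn ℝ n f W) (hW : IsOpen W) (hWc : Convex ℝ W) (hi : i + 1 < n) {K : ℝ}
    (hK : ∀ v ∈ W, ‖iteratedFDerivWithin ℝ (i + 2) f W v‖ ≤ K) {v w : V} (hv : v ∈ W)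
    (hw : w ∈ W) :
    ‖iteratedFDerivWithin ℝ i f W w - iteratedFDerivWithin ℝ i f W v
      - (iteratedFDerivWithin ℝ (i + 1) f W v).curryLeft (w - v)‖ ≤ K * ‖w - v‖ ^ 2 := by
  have hK0 : 0 ≤ K := (norm_nonneg _).trans (hK v hv)
  have hconv : Convex ℝ (W ∩ Metric.closedBall v ‖w - v‖) :=
    hWc.inter (convex_closedBall _ _)
  rw [pow_two, ← mul_assoc]
  refine hconv.norm_image_sub_le_of_norm_hasFDerivWithin_le'
    (fun u hu => (hasFDerivWithinAt_iteratedFDerivWithin hf hW (by omega) hu.1).mono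
      inter_subset_left) (fun u hu => ?_) ⟨hv, by simp⟩ ⟨hw, by simp [dist_eq_norm]⟩
  have hsub : (iteratedFDerivWithin ℝ (i + 1) f W u).curryLeft
      - (iteratedFDerivWithin ℝ (i + 1) f W v).curryLeft
      = (iteratedFDerivWithin ℝ (i + 1) f W u - iteratedFDerivWithin ℝ (i + 1) f W v).curryLeft :=
    rfl
  rw [hsub, ContinuousMultilinearMap.curryLeft_norm]
  refine (norm_iteratedFDerivWithin_sub_le hf hW hWc hi hK hv hu.1).trans ?_
  exact mul_le_mul_of_nonneg_left (by simpa [dist_eq_norm] using hu.2) hK0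

theorem stronglyMeasurable_iteratedFDerivWithin_apply {φ : S → V → X} {W : Set V} {n : ℕ}
    (hφ : ∀ s, ContDiffOn ℝ n (φ s) W) (hW : IsOpen W)
    (hmeas : ∀ v ∈ W, StronglyMeasurable fun s => φ s v) :
    ∀ i ≤ n, ∀ v ∈ W, ∀ u : Fin i → V,
      StronglyMeasurable fun s => iteratedFDerivWithin ℝ i (φ s) W v u := by
  intro i
  induction i with
  | zero => intro _ v hv u; simpa using hmeas v hv
  | succ i ih =>
    intro hi v hv u
    have hev : ∀ᶠ N : ℕ in Filter.atTop, v + ((N : ℝ)⁻¹) • u 0 ∈ W := by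
      have h1 : Filter.Tendsto (fun N : ℕ => v + ((N : ℝ)⁻¹) • u 0) Filter.atTop (𝓝 v) := by
        simpa using tendsto_const_nhds.add
          ((tendsto_inv_atTop_nhds_zero_nat (𝕜 := ℝ)).smul_const (u 0))
      exact h1 (hW.mem_nhds hv)
    obtain ⟨N₀, hN₀⟩ := Filter.eventually_atTop.1 hev
    have hc : Filter.Tendsto (fun N : ℕ => ‖((N + N₀ : ℕ) : ℝ)‖) Filter.atTop Filter.atTop :=
      tendsto_norm_atTop_atTop.comp
        (tendsto_natCast_atTop_atTop.comp (Filter.tendsto_add_atTop_nat N₀))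
    refine stronglyMeasurable_of_tendsto Filter.atTop
      (f := fun (N : ℕ) s => ((N + N₀ : ℕ) : ℝ) •
        (iteratedFDerivWithin ℝ i (φ s) W (v + (((N + N₀ : ℕ) : ℝ)⁻¹) • u 0) (Fin.tail u)
          - iteratedFDerivWithin ℝ i (φ s) W v (Fin.tail u))) (fun N => ?_) ?_
    · exact ((ih (by omega) _ (hN₀ _ (by omega)) _).sub (ih (by omega) v hv _)).const_smul _
    · rw [tendsto_pi_nhds]
      intro s
      have hd := (hasFDerivWithinAt_iteratedFDerivWithin (hφ s) hW (i := i) (by omega)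
        hv).hasFDerivAt (hW.mem_nhds hv)
      have := hd.lim (u 0) hc
      have := ((ContinuousMultilinearMap.apply ℝ (fun _ : Fin i => V) X
        (Fin.tail u)).continuous.tendsto _).comp this
      simpa [Function.comp_def, Fin.cons_self_tail] using this

/-- A linear operator on a weighted space, applied to a family of functions with uniformly
bounded derivatives up to order `n + 1`, gives a `C^n` map. -/
theorem contDiffOn_of_forall_norm_iteratedFDerivWithin_le {m : S → ℝ}
    (Λ : weightedBounded X m →ₗ[ℝ] Y) {B : ℝ} (hB : 0 ≤ B)
    (hΛ : ∀ (h : weightedBounded X m) (K : ℝ), 0 ≤ K →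
      (∀ s, ‖(h : S → X) s‖ ≤ K * m s) → ‖Λ h‖ ≤ B * K)
    {φ : S → V → X} {W : Set V} {n : ℕ} (hW : IsOpen W) (hWc : Convex ℝ W)
    (hφ : ∀ s, ContDiffOn ℝ ((n + 1 : ℕ) : WithTop ℕ∞) (φ s) W) {K : ℝ} (hK : 0 ≤ K)
    (hbd : ∀ i ≤ n + 1, ∀ s, ∀ v ∈ W, ‖iteratedFDerivWithin ℝ i (φ s) W v‖ ≤ K * m s)
    (hmeas : ∀ v ∈ W, StronglyMeasurable fun s => φ s v) {Φ : V → Y}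
    (hΦ : ∀ v ∈ W, ∀ h : weightedBounded X m, (∀ s, (h : S → X) s = φ s v) → Φ v = Λ h) :
    ContDiffOn ℝ n Φ W := by
  have hmem : ∀ i ≤ n + 1, ∀ v ∈ W, ∀ u : Fin i → V,
      (fun s => iteratedFDerivWithin ℝ i (φ s) W v u) ∈ weightedBounded X m := by
    intro i hi v hv u
    refine ⟨stronglyMeasurable_iteratedFDerivWithin_apply hφ hW hmeas i hi v hv u,
      K * ∏ j, ‖u j‖, fun s => ?_⟩
    refine (ContinuousMultilinearMap.le_opNorm _ _).trans ?_
    rw [mul_right_comm]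
    exact mul_le_mul_of_nonneg_right (hbd i hi s v hv)
      (Finset.prod_nonneg fun j _ => norm_nonneg (u j))
  have hex : ∀ (v : V) (i : ℕ), ∃ M : ContinuousMultilinearMap ℝ (fun _ : Fin i => V) Y,
      i ≤ n + 1 → v ∈ W → ∀ (u : Fin i → V) (h : weightedBounded X m),
        (∀ s, (h : S → X) s = iteratedFDerivWithin ℝ i (φ s) W v u) → M u = Λ h := by
    intro v i
    by_cases hi : i ≤ n + 1
    · by_cases hv : v ∈ W
      · let M₀ : MultilinearMap ℝ (fun _ : Fin i => V) (weightedBounded X m) :=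
          { toFun := fun u => ⟨_, hmem i hi v hv u⟩
            map_update_add' := by
              intro _ u j a b
              ext s
              simp
            map_update_smul' := by
              intro _ u j a b
              ext s
              simp }
        refine ⟨(Λ.compMultilinearMap M₀).mkContinuous (B * K) fun u => ?_, fun _ _ u h hh => ?_⟩
        · rw [mul_assoc]
          refine hΛ _ _ (mul_nonneg hK (Finset.prod_nonneg fun j _ => norm_nonneg (u j)))
            fun s => (ContinuousMultilinearMap.le_opNorm _ _).trans ?_
          rw [mul_right_comm]
          exact mul_le_mul_of_nonneg_right (hbd i hi s v hv)
            (Finset.prod_nonneg fun j _ => norm_nonneg (u j))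
        · exact congrArg Λ (Subtype.ext (funext fun s => (hh s).symm))
      · exact ⟨0, fun _ h => absurd h hv⟩
    · exact ⟨0, fun h => absurd h hi⟩
  choose p hp using hex
  have hp' : ∀ i (hi : i ≤ n + 1) v (hv : v ∈ W) u, p v i u = Λ ⟨_, hmem i hi v hv u⟩ :=
    fun i hi v hv u => hp v i hi hv u _ fun _ => rfl
  have htaylor : HasFTaylorSeriesUpToOn (n : WithTop ℕ∞) Φ p W := by
    refine ⟨fun v hv => ?_, fun i hi v hv => ?_, fun i hi => ?_⟩
    · rw [ContinuousMultilinearMap.curry0, hp' 0 (by omega) v hv]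
      exact (hΦ v hv _ fun s => by simp).symm
    · have hi' : i < n := by exact_mod_cast hi
      refine .of_isLittleO ?_
      have hO : (fun w => p w i - p v i - (p v (i + 1)).curryLeft (w - v)) =O[𝓝[W] v]
          fun w => ‖w - v‖ ^ 2 := by
        refine Asymptotics.IsBigO.of_bound (B * K)
          (Filter.eventually_of_mem self_mem_nhdsWithin fun w hw => ?_)
        rw [Real.norm_of_nonneg (by positivity)]
        refine ContinuousMultilinearMap.opNorm_le_bound (by positivity) fun u => ?_
        simp only [sub_apply, ContinuousMultilinearMap.curryLeft_apply]
        rw [hp' i (by omega) w hw, hp' i (by omega) v hv, hp' (i + 1) (by omega) v hv,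
          ← map_sub, ← map_sub, mul_assoc, mul_assoc]
        refine hΛ _ _ (by positivity) fun s => ?_
        refine (ContinuousMultilinearMap.le_of_opNorm_le (norm_iteratedFDerivWithin_sub_sub_le
          (hφ s) hW hWc (by omega) (fun v hv => hbd (i + 2) (by omega) s v hv) hv hw) u).trans
          (le_of_eq (by ring))
      refine hO.trans_isLittleO ?_
      exact ((Asymptotics.isLittleO_pow_sub_sub v one_lt_two).mono nhdsWithin_le_nhds)
    · have hi' : i ≤ n := by exact_mod_cast hi
      refine LipschitzOnWith.continuousOn (K := (B * K).toNNReal)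
        (LipschitzOnWith.of_dist_le_mul fun w hw v hv => ?_)
      rw [Real.coe_toNNReal _ (by positivity), dist_eq_norm, dist_eq_norm]
      refine ContinuousMultilinearMap.opNorm_le_bound (by positivity) fun u => ?_
      rw [sub_apply, hp' i (by omega) w hw, hp' i (by omega) v hv,
        ← map_sub, mul_assoc, mul_assoc]
      refine hΛ _ _ (by positivity) fun s => ?_
      refine (ContinuousMultilinearMap.le_of_opNorm_le (norm_iteratedFDerivWithin_sub_le
        (hφ s) hW hWc (by omega) (fun v hv => hbd (i + 1) (by omega) s v hv) hv hw) u).trans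
        (le_of_eq (by ring))
  exact htaylor.contDiffOn

end WeightedSpace

section GreenOperator

variable {X : Type*} [NormedAddCommGroup X] [NormedSpace ℝ X] [CompleteSpace X]
  {A : ℝ → X →L[ℝ] X} {T : ℝ → ℝ → X →L[ℝ] X} {P : ℝ → X →L[ℝ] X} {G : ℝ → ℝ → X →L[ℝ] X}

/-- The integral operator with kernel the Green function maps a weighted space into the bounded
continuous functions. -/
theorem IsGreenFunction.exists_linearMap (hT : IsEvolutionFamily A T)
    (hP : Continuous P) (hG : IsGreenFunction T P G) {m : ℝ → ℝ} (hm : Continuous m)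
    (hm0 : ∀ s, 0 ≤ m s) (hintegrable : ∀ t, Integrable fun s => m s * ‖G t s‖) {B : ℝ}
    (hB : ∀ t, ∫ s, m s * ‖G t s‖ ≤ B) :
    ∃ Λ : weightedBounded X m →ₗ[ℝ] (ℝ →ᵇ X),
      (∀ h t, Λ h t = ∫ s, G t s ((h : ℝ → X) s)) ∧
      ∀ (h : weightedBounded X m) (K : ℝ), 0 ≤ K →
        (∀ s, ‖(h : ℝ → X) s‖ ≤ K * m s) → ‖Λ h‖ ≤ B * K := by
  have hB0 : 0 ≤ B :=
    (integral_nonneg fun s => mul_nonneg (hm0 s) (norm_nonneg _)).trans (hB 0)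
  have hKint : ∀ (K t : ℝ), Integrable fun s => K * m s * ‖G t s‖ := fun K t => by
    simpa only [mul_assoc] using (hintegrable t).const_mul K
  have hi : ∀ (h : weightedBounded X m) t, Integrable fun s => G t s ((h : ℝ → X) s) := by
    rintro ⟨h, hh, K, hK⟩ t
    exact hG.integrable_apply hT hP hh (hKint K t) hK
  have hle : ∀ (h : weightedBounded X m) (K : ℝ), 0 ≤ K → (∀ s, ‖(h : ℝ → X) s‖ ≤ K * m s) →
      ∀ t, ‖∫ s, G t s ((h : ℝ → X) s)‖ ≤ B * K := by
    intro h K hK0 hK t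
    refine (norm_integral_green_le (hKint K t) hK).trans ?_
    simp_rw [mul_assoc]
    rw [integral_const_mul, mul_comm]
    exact mul_le_mul_of_nonneg_right (hB t) hK0
  have hcont : ∀ h : weightedBounded X m, Continuous fun t => ∫ s, G t s ((h : ℝ → X) s) := by
    rintro ⟨h, hh, K, hK⟩
    refine hG.continuous_integral hT (fun a b => ?_) (hi ⟨h, hh, K, hK⟩ 0)
    have hTc := hT.continuous_right 0
    have hdom : Continuous fun s => ‖T 0 s‖ * (K * m s) :=
      hTc.norm.mul (continuous_const.mul hm)
    refine (hdom.intervalIntegrable a b).mono_fun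
      ((isBoundedBilinearMap_apply (𝕜 := ℝ) (E := X) (F := X)).continuous
        |>.comp_stronglyMeasurable (hTc.stronglyMeasurable.prodMk hh)).aestronglyMeasurable
      (Filter.Eventually.of_forall fun s => ?_)
    exact ((T 0 s).le_opNorm_of_le (hK s)).trans (le_abs_self _)
  have hbdd : ∀ h : weightedBounded X m, ∃ R, ∀ t, ‖∫ s, G t s ((h : ℝ → X) s)‖ ≤ R := by
    rintro ⟨h, hh, K, hK⟩
    refine ⟨B * |K|, hle ⟨h, hh, K, hK⟩ |K| (abs_nonneg K) fun s => (hK s).trans ?_⟩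
    exact mul_le_mul_of_nonneg_right (le_abs_self K) (hm0 s)
  choose R hR using hbdd
  refine ⟨{ toFun := fun h =>
              BoundedContinuousFunction.ofNormedAddCommGroup _ (hcont h) (R h) (hR h)
            map_add' := fun h h' => ?_
            map_smul' := fun r h => ?_ }, fun h t => rfl, fun h K hK0 hK => ?_⟩
  · ext t
    simp [integral_add (hi h t) (hi h' t)]
  · ext t
    simp [integral_smul]
  · exact (BoundedContinuousFunction.norm_le (mul_nonneg hB0 hK0)).2 (hle h K hK0 hK)

end GreenOperator

section ImplicitFixedPoint

variable {E : Type*} [NormedAddCommGroup E] [NormedSpace ℝ E]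
  {Y : Type*} [NormedAddCommGroup Y] [NormedSpace ℝ Y]

theorem norm_fderiv_comp_inr_le {F : E × Y → Y} {q : ℝ} (hq : 0 ≤ q) {p : E × Y}
    (hF : DifferentiableAt ℝ F p) {V : Set (E × Y)} (hV : V ∈ 𝓝 p)
    (hlip : ∀ l u v, (l, u) ∈ V → (l, v) ∈ V → ‖F (l, u) - F (l, v)‖ ≤ q * ‖u - v‖) :
    ‖(fderiv ℝ F p).comp (ContinuousLinearMap.inr ℝ E Y)‖ ≤ q := by
  have hin : HasFDerivAt (fun u : Y => (p.1, u)) (ContinuousLinearMap.inr ℝ E Y) p.2 :=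
    hasFDerivAt_prodMk_right p.1 p.2
  have hd : HasFDerivAt (fun u => F (p.1, u))
      ((fderiv ℝ F p).comp (ContinuousLinearMap.inr ℝ E Y)) p.2 :=
    HasFDerivAt.comp (g := F) p.2 (hF.hasFDerivAt (x := p)) hin
  refine hd.le_of_lip' hq ?_
  filter_upwards [hin.continuousAt.preimage_mem_nhds hV] with u hu
  exact hlip _ _ _ hu (mem_of_mem_nhds hV)

/-- Fixed points of a smooth family of uniform contractions depend smoothly on the parameter. -/
theorem contDiffOn_fixedPoint [CompleteSpace Y] {F : E × Y → Y} {S : Set E} {D : Set Y}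
    (hS : IsOpen S) (hD : IsOpen D) {n : ℕ} (hn : 1 ≤ n) (hF : ContDiffOn ℝ n F (S ×ˢ D))
    {q : ℝ} (hq0 : 0 ≤ q) (hq1 : q < 1)
    (hlip : ∀ l ∈ S, ∀ u ∈ D, ∀ v ∈ D, ‖F (l, u) - F (l, v)‖ ≤ q * ‖u - v‖) {z : E → Y}
    (hz : MapsTo z S D) (hfix : ∀ l ∈ S, F (l, z l) = z l) : ContDiffOn ℝ n z S := by
  have hSD : IsOpen (S ×ˢ D) := hS.prod hD
  have hmemV : ∀ l ∈ S, S ×ˢ D ∈ 𝓝 (l, z l) := fun l hl => hSD.mem_nhds ⟨hl, hz hl⟩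
  have hFd : ∀ l ∈ S, DifferentiableAt ℝ F (l, z l) := fun l hl =>
    (hF.contDiffAt (hmemV l hl)).differentiableAt (by positivity)
  set F₁ : E → E →L[ℝ] Y := fun l =>
    (fderiv ℝ F (l, z l)).comp (ContinuousLinearMap.inl ℝ E Y) with hF₁
  set F₂ : E → Y →L[ℝ] Y := fun l =>
    (fderiv ℝ F (l, z l)).comp (ContinuousLinearMap.inr ℝ E Y) with hF₂
  have hF₂le : ∀ l ∈ S, ‖F₂ l‖ < 1 := fun l hl =>
    (norm_fderiv_comp_inr_le hq0 (hFd l hl) (hmemV l hl) fun l u v hu hv =>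
      hlip l hu.1 u hu.2 v hv.2).trans_lt hq1
  have hunit : ∀ l ∈ S, IsUnit (1 - F₂ l) := fun l hl => isUnit_one_sub_of_norm_lt_one (hF₂le l hl)
  have hO : ∀ l ∈ S, (fun l' => z l' - z l) =O[𝓝 l] fun l' => l' - l := by
    intro l hl
    have hd : HasFDerivAt (fun l' => F (l', z l)) (F₁ l) l :=
      HasFDerivAt.comp (g := F) l ((hFd l hl).hasFDerivAt) (hasFDerivAt_prodMk_left l (z l))
    refine Asymptotics.IsBigO.trans (.of_bound (1 - q)⁻¹ ?_) hd.isBigO_sub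
    filter_upwards [hS.mem_nhds hl] with l' hl'
    have h1 : z l' - z l = (F (l', z l') - F (l', z l)) + (F (l', z l) - F (l, z l)) := by
      rw [hfix l' hl', hfix l hl]; abel
    have h2 := norm_add_le (F (l', z l') - F (l', z l)) (F (l', z l) - F (l, z l))
    rw [← h1] at h2
    have h3 := hlip l' hl' _ (hz hl') _ (hz hl)
    rw [inv_mul_eq_div, le_div_iff₀ (by linarith)]
    linarith
  have hderiv : ∀ l ∈ S, HasFDerivAt z ((Ring.inverse (1 - F₂ l)).comp (F₁ l)) l := by
    intro l hl
    have hzc : ContinuousAt z l := by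
      have h0 : Filter.Tendsto (fun l' => l' - l) (𝓝 l) (𝓝 0) :=
        tendsto_sub_nhds_zero_iff.2 Filter.tendsto_id
      exact tendsto_sub_nhds_zero_iff.1 ((hO l hl).trans_tendsto h0)
    have htend : Filter.Tendsto (fun l' => (l', z l')) (𝓝 l) (𝓝 (l, z l)) :=
      (continuousAt_id.prodMk hzc)
    have hlo := ((hFd l hl).hasFDerivAt.isLittleO).comp_tendsto htend
    have hprod : (fun l' => ((l', z l') : E × Y) - (l, z l)) =O[𝓝 l] fun l' => l' - l :=
      (Asymptotics.isBigO_refl _ _).prod_left (hO l hl)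
    have hlo' := hlo.trans_isBigO hprod
    refine .of_isLittleO ?_
    have hcomp := ((Ring.inverse (1 - F₂ l)).isBigO_comp (fun l' : E =>
      F (l', z l') - F (l, z l) - fderiv ℝ F (l, z l) ((l', z l') - (l, z l)))
        (𝓝 l)).trans_isLittleO hlo'
    refine hcomp.congr' ?_ Filter.EventuallyEq.rfl
    filter_upwards [hS.mem_nhds hl] with l' hl'
    have hinv : (Ring.inverse (1 - F₂ l)).comp (1 - F₂ l) = 1 :=
      Ring.inverse_mul_cancel _ (hunit l hl)
    have hsplit : fderiv ℝ F (l, z l) ((l', z l') - (l, z l))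
        = F₁ l (l' - l) + F₂ l (z l' - z l) := by
      simp [hF₁, hF₂, ← map_add]
    have happ : Ring.inverse (1 - F₂ l) ((1 - F₂ l) (z l' - z l)) = z l' - z l :=
      congrArg (fun Q : Y →L[ℝ] Y => Q (z l' - z l)) hinv
    clear_value F₁ F₂
    rw [hfix l' hl', hfix l hl, hsplit, ContinuousLinearMap.comp_apply, ← sub_sub, sub_right_comm,
      map_sub]
    nth_rewrite 3 [← happ]
    simp
  have hzc : ContinuousOn z S := fun l hl => (hderiv l hl).continuousAt.continuousWithinAt
  have hfd : ContDiffOn ℝ ((n - 1 : ℕ) : WithTop ℕ∞) (fderiv ℝ F) (S ×ˢ D) :=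
    hF.fderiv_of_isOpen hSD (by norm_cast; omega)
  have main : ∀ j ≤ n, ContDiffOn ℝ (j : WithTop ℕ∞) z S := by
    intro j
    induction j with
    | zero => intro _; exact contDiffOn_zero.2 hzc
    | succ j ih =>
      intro hj
      have hzj := ih (by omega)
      push_cast
      refine (contDiffOn_succ_iff_fderiv_of_isOpen hS).2
        ⟨fun l hl => (hderiv l hl).differentiableAt.differentiableWithinAt, by simp, ?_⟩
      have hcomp : ContDiffOn ℝ (j : WithTop ℕ∞) (fun l => fderiv ℝ F (l, z l)) S :=
        (hfd.of_le (by norm_cast; omega)).comp (contDiffOn_id.prodMk hzj)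
          fun l hl => ⟨hl, hz hl⟩
      have h1 : ContDiffOn ℝ (j : WithTop ℕ∞) F₁ S := hcomp.clm_comp contDiffOn_const
      have h2 : ContDiffOn ℝ (j : WithTop ℕ∞) F₂ S := hcomp.clm_comp contDiffOn_const
      have h3 : ContDiffOn ℝ (j : WithTop ℕ∞) (fun l => Ring.inverse (1 - F₂ l)) S := by
        intro l hl
        obtain ⟨U, hU⟩ := hunit l hl
        refine ContDiffAt.comp_contDiffWithinAt (g := Ring.inverse) l ?_
          ((contDiffOn_const.sub h2) l hl)
        rw [← hU]
        exact contDiffAt_ringInverse ℝ U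
      refine (h3.clm_comp h1).congr fun l hl => (hderiv l hl).fderiv
  exact main n le_rfl

end ImplicitFixedPoint

section DerivativeBounds

variable {V : Type*} [NormedAddCommGroup V] [NormedSpace ℝ V]
  {U : Type*} [NormedAddCommGroup U] [NormedSpace ℝ U]
  {X : Type*} [NormedAddCommGroup X] [NormedSpace ℝ X]

theorem norm_iteratedFDerivWithin_add_le {f g : V → X} {W : Set V} (hW : IsOpen W) {n i : ℕ}
    (hi : i ≤ n) (hf : ContDiffOn ℝ n f W) (hg : ContDiffOn ℝ n g W) {v : V} (hv : v ∈ W)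
    {a b : ℝ} (ha : ‖iteratedFDerivWithin ℝ i f W v‖ ≤ a)
    (hb : ‖iteratedFDerivWithin ℝ i g W v‖ ≤ b) :
    ‖iteratedFDerivWithin ℝ i (fun v => f v + g v) W v‖ ≤ a + b := by
  have hi' : (i : WithTop ℕ∞) ≤ n := by exact_mod_cast hi
  have := iteratedFDerivWithin_add_apply ((hf v hv).of_le hi') ((hg v hv).of_le hi')
    hW.uniqueDiffOn hv
  change ‖iteratedFDerivWithin ℝ i (f + g) W v‖ ≤ a + b
  rw [this]
  exact (norm_add_le _ _).trans (add_le_add ha hb)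

theorem norm_iteratedFDerivWithin_sub_le' {f g : V → X} {W : Set V} (hW : IsOpen W) {n i : ℕ}
    (hi : i ≤ n) (hf : ContDiffOn ℝ n f W) (hg : ContDiffOn ℝ n g W) {v : V} (hv : v ∈ W)
    {a b : ℝ} (ha : ‖iteratedFDerivWithin ℝ i f W v‖ ≤ a)
    (hb : ‖iteratedFDerivWithin ℝ i g W v‖ ≤ b) :
    ‖iteratedFDerivWithin ℝ i (fun v => f v - g v) W v‖ ≤ a + b := by
  have hi' : (i : WithTop ℕ∞) ≤ n := by exact_mod_cast hi
  have := iteratedFDerivWithin_sub_apply ((hf v hv).of_le hi') ((hg v hv).of_le hi')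
    hW.uniqueDiffOn hv
  change ‖iteratedFDerivWithin ℝ i (f - g) W v‖ ≤ a + b
  rw [this]
  exact (norm_sub_le _ _).trans (add_le_add ha hb)

theorem norm_iteratedFDerivWithin_comp_right_le {f : U → X} {W : Set U} (hW : IsOpen W) {n i : ℕ}
    (hi : i ≤ n) (hf : ContDiffOn ℝ n f W) (l : V →L[ℝ] U) (hl : ‖l‖ ≤ 1) {v : V}
    (hv : l v ∈ W) :
    ‖iteratedFDerivWithin ℝ i (fun v => f (l v)) (l ⁻¹' W) v‖
      ≤ ‖iteratedFDerivWithin ℝ i f W (l v)‖ := by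
  have := l.iteratedFDerivWithin_comp_right hf hW.uniqueDiffOn
    (hW.preimage l.continuous).uniqueDiffOn hv (i := i) (by exact_mod_cast hi)
  change ‖iteratedFDerivWithin ℝ i (f ∘ l) (l ⁻¹' W) v‖ ≤ _
  rw [this]
  refine (ContinuousMultilinearMap.norm_compContinuousLinearMap_le _ _).trans ?_
  refine mul_le_of_le_one_right (norm_nonneg _) ?_
  exact Finset.prod_le_one (fun _ _ => norm_nonneg _) fun _ _ => hl

theorem norm_iteratedFDerivWithin_clm_le (l : V →L[ℝ] X) {W : Set V} (hW : IsOpen W) {i : ℕ}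
    (hi : 1 ≤ i) {v : V} (hv : v ∈ W) : ‖iteratedFDerivWithin ℝ i l W v‖ ≤ ‖l‖ := by
  obtain ⟨j, rfl⟩ := Nat.exists_eq_add_of_le' hi
  have hfd : ∀ w ∈ W, fderivWithin ℝ l W w = l := fun w hw =>
    l.fderivWithin (hW.uniqueDiffOn w hw)
  rw [← norm_iteratedFDerivWithin_fderivWithin hW.uniqueDiffOn hv,
    iteratedFDerivWithin_congr hfd hv]
  rcases Nat.eq_zero_or_pos j with rfl | hj
  · simp
  · rw [iteratedFDerivWithin_const_of_ne hj.ne']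
    simp

theorem norm_iteratedFDerivWithin_sub_clm_comp_le {f : U → X} {θ : V → U} {Ω : Set U} {W : Set V}
    (hΩ : IsOpen Ω) (hW : IsOpen W) {n i : ℕ} (hi1 : 1 ≤ i) (hi : i ≤ n)
    (hf : ContDiffOn ℝ n f Ω) (hθ : ContDiffOn ℝ n θ W) (hmaps : MapsTo θ W Ω) (L : U →L[ℝ] X)
    {v : V} (hv : v ∈ W) {η D : ℝ} (h1 : ‖fderivWithin ℝ f Ω (θ v) - L‖ ≤ η)
    (h2 : ∀ j, 2 ≤ j → j ≤ n → ‖iteratedFDerivWithin ℝ j f Ω (θ v)‖ ≤ η)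
    (hD : ∀ j, 1 ≤ j → j ≤ n → ‖iteratedFDerivWithin ℝ j θ W v‖ ≤ D ^ j) :
    ‖iteratedFDerivWithin ℝ i (fun w => f (θ w) - L (θ w)) W v‖ ≤ i.factorial * η * D ^ i := by
  have hη : 0 ≤ η := (norm_nonneg _).trans h1
  have hθv := hmaps hv
  set g : U → X := fun u => f u - L u - (f (θ v) - L (θ v)) with hg
  have hgc : ContDiffOn ℝ n g Ω := (hf.sub L.contDiff.contDiffOn).sub contDiffOn_const
  have hfd : ∀ u ∈ Ω, fderivWithin ℝ g Ω u = fderivWithin ℝ f Ω u - L := by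
    intro u hu
    have hfu : DifferentiableWithinAt ℝ f Ω u :=
      (hf u hu).differentiableWithinAt (by norm_cast; omega)
    exact ((hfu.hasFDerivWithinAt.sub L.hasFDerivWithinAt).sub_const _).fderivWithin
      (hΩ.uniqueDiffOn u hu)
  have hgb : ∀ j ≤ n, ‖iteratedFDerivWithin ℝ j g Ω (θ v)‖ ≤ η := by
    intro j hj
    rcases j with _ | _ | j
    · simpa [hg] using hη
    · rw [zero_add, norm_iteratedFDerivWithin_one _ (hΩ.uniqueDiffOn _ hθv), hfd _ hθv]
      exact h1
    · have hfn : ContDiffOn ℝ (j + 1 : ℕ) (fderivWithin ℝ f Ω) Ω :=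
        hf.fderivWithin hΩ.uniqueDiffOn (by norm_cast)
      rw [← norm_iteratedFDerivWithin_fderivWithin hΩ.uniqueDiffOn hθv,
        iteratedFDerivWithin_congr hfd hθv]
      change ‖iteratedFDerivWithin ℝ (j + 1) (fderivWithin ℝ f Ω - fun _ => L) Ω (θ v)‖ ≤ η
      rw [iteratedFDerivWithin_sub_apply (hfn _ hθv) contDiffWithinAt_const hΩ.uniqueDiffOn hθv,
        iteratedFDerivWithin_const_of_ne (by omega)]
      simpa [norm_iteratedFDerivWithin_fderivWithin hΩ.uniqueDiffOn hθv]
        using h2 (j + 2) (by omega) hj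
  have hcomp := norm_iteratedFDerivWithin_comp_le hgc hθ (n := i) (by exact_mod_cast hi)
    hΩ.uniqueDiffOn hW.uniqueDiffOn hmaps hv (fun j hj => hgb j (hj.trans hi))
    (fun j hj1 hj => hD j hj1 (hj.trans hi))
  have hlin : ContDiffOn ℝ n (fun w => f (θ w) - L (θ w)) W :=
    (hf.comp hθ hmaps).sub (L.contDiff.comp_contDiffOn hθ)
  have hsub : iteratedFDerivWithin ℝ i (g ∘ θ) W v
      = iteratedFDerivWithin ℝ i (fun w => f (θ w) - L (θ w)) W v := by
    change iteratedFDerivWithin ℝ i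
      ((fun w => f (θ w) - L (θ w)) - fun _ => f (θ v) - L (θ v)) W v = _
    rw [iteratedFDerivWithin_sub_apply ((hlin v hv).of_le (by exact_mod_cast hi))
      contDiffWithinAt_const hW.uniqueDiffOn hv, iteratedFDerivWithin_const_of_ne (by omega)]
    simp
  rwa [hsub] at hcomp

variable {E : Type*} [NormedAddCommGroup E] [NormedSpace ℝ E]

theorem norm_iteratedFDerivWithin_clm_add_graph_le {y : E → X} {S : Set E} (hS : IsOpen S)
    {n i : ℕ} (hi1 : 1 ≤ i) (hi : i ≤ n) (hy : ContDiffOn ℝ n y S)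
    (l : E × X →L[ℝ] E × X) (hl : ‖l‖ ≤ 1) {v : E × X} (hv : v.1 ∈ S) {M : ℝ} (hM : 0 ≤ M)
    (hyM : ‖iteratedFDerivWithin ℝ i y S v.1‖ ≤ M) :
    ‖iteratedFDerivWithin ℝ i (fun p : E × X => l p + ((0 : E), y p.1)) (Prod.fst ⁻¹' S) v‖
      ≤ (1 + M) ^ i := by
  have hΩ : IsOpen ((Prod.fst : E × X → E) ⁻¹' S) := hS.preimage continuous_fst
  have hyf : ContDiffOn ℝ n (fun p : E × X => y p.1) (Prod.fst ⁻¹' S) :=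
    hy.comp contDiffOn_fst fun _ hp => hp
  have hyl : ContDiffOn ℝ n (fun p : E × X => ((0 : E), y p.1)) (Prod.fst ⁻¹' S) :=
    contDiffOn_const.prodMk hyf
  have h1 : ‖iteratedFDerivWithin ℝ i (fun p : E × X => y p.1) (Prod.fst ⁻¹' S) v‖ ≤ M :=
    (norm_iteratedFDerivWithin_comp_right_le hS hi hy (ContinuousLinearMap.fst ℝ E X)
      (ContinuousLinearMap.norm_fst_le ..) hv).trans hyM
  have h2 : ‖iteratedFDerivWithin ℝ i (fun p : E × X => ((0 : E), y p.1)) (Prod.fst ⁻¹' S) v‖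
      ≤ M := by
    refine ((ContinuousLinearMap.inr ℝ E X).norm_iteratedFDerivWithin_comp_left (hyf v hv)
      hΩ.uniqueDiffOn hv (by exact_mod_cast hi)).trans ?_
    refine (mul_le_of_le_one_left (norm_nonneg _) (ContinuousLinearMap.norm_inr_le_one ..)).trans h1
  refine (norm_iteratedFDerivWithin_add_le hΩ hi l.contDiff.contDiffOn hyl hv
    ((norm_iteratedFDerivWithin_clm_le l hΩ hi1 hv).trans hl) h2).trans ?_
  exact le_self_pow₀ (by linarith) (by omega)

/-- The increment of a Lipschitz map with bounded second and higher derivatives, measured along a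
smooth graph `y`, has bounded derivatives. -/
theorem norm_iteratedFDerivWithin_shift_sub_le {f : E × X → X} {y : E → X} {S : Set E}
    (hS : IsOpen S) {n i : ℕ} (hn : 2 ≤ n) (hi1 : 1 ≤ i) (hi : i ≤ n)
    (hf : ContDiffOn ℝ n f (Prod.fst ⁻¹' S)) (hy : ContDiffOn ℝ n y S) {η c M R : ℝ}
    (hη : ∀ j, 2 ≤ j → j ≤ n → ∀ p : E × X, p.1 ∈ S →
      ‖iteratedFDerivWithin ℝ j f (Prod.fst ⁻¹' S) p‖ ≤ η)
    (hc : 0 ≤ c) (hlip : ∀ l ∈ S, ∀ u v, ‖f (l, u) - f (l, v)‖ ≤ c * ‖u - v‖) {v : E × X}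
    (hv : v.1 ∈ S) (hM : 0 ≤ M)
    (hyM : ∀ j, 1 ≤ j → j ≤ n → ‖iteratedFDerivWithin ℝ j y S v.1‖ ≤ M) (hR : 1 ≤ R)
    (hvR : ‖v.2‖ ≤ R) :
    ‖iteratedFDerivWithin ℝ i (fun p : E × X => f (p.1, y p.1 + p.2) - f (p.1, y p.1))
      (Prod.fst ⁻¹' S) v‖ ≤ 2 * (i.factorial * (η * R) * (1 + M) ^ i) + c := by
  set Ω : Set (E × X) := Prod.fst ⁻¹' S with hΩdef
  have hΩ : IsOpen Ω := hS.preimage continuous_fst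
  have hη0 : 0 ≤ η := (norm_nonneg _).trans (hη 2 le_rfl hn v hv)
  have hηR : η ≤ η * R := le_mul_of_one_le_right hη0 hR
  have hyl : ContDiffOn ℝ n (fun p : E × X => ((0 : E), y p.1)) Ω :=
    contDiffOn_const.prodMk (hy.comp contDiffOn_fst fun _ hp => hp)
  set l₀ : E × X →L[ℝ] E × X :=
    (ContinuousLinearMap.inl ℝ E X).comp (ContinuousLinearMap.fst ℝ E X) with hl₀
  have hl₀n : ‖l₀‖ ≤ 1 := (ContinuousLinearMap.opNorm_comp_le _ _).trans
    (mul_le_one₀ (ContinuousLinearMap.norm_inl_le_one ..) (norm_nonneg _)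
      (ContinuousLinearMap.norm_fst_le ..))
  set l₁ : E × X →L[ℝ] E × X := ContinuousLinearMap.id ℝ (E × X) with hl₁
  have hl₁n : ‖l₁‖ ≤ 1 := ContinuousLinearMap.norm_id_le
  set θ₀ : E × X → E × X := fun p => l₀ p + ((0 : E), y p.1) with hθ₀
  set θ₁ : E × X → E × X := fun p => l₁ p + ((0 : E), y p.1) with hθ₁
  have hθ₀' : ∀ p, θ₀ p = (p.1, y p.1) := fun p => by simp [hθ₀, hl₀]
  have hθ₁' : ∀ p, θ₁ p = (p.1, y p.1 + p.2) := fun p => by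
    ext <;> simp [hθ₁, hl₁, add_comm]
  have hθ₀c : ContDiffOn ℝ n θ₀ Ω := l₀.contDiff.contDiffOn.add hyl
  have hθ₁c : ContDiffOn ℝ n θ₁ Ω := l₁.contDiff.contDiffOn.add hyl
  have hm₀ : MapsTo θ₀ Ω Ω := fun p hp => by simpa [hΩdef, hθ₀'] using hp
  have hm₁ : MapsTo θ₁ Ω Ω := fun p hp => by simpa [hΩdef, hθ₁'] using hp
  set L := fderivWithin ℝ f Ω (θ₀ v) with hL
  have hfd : ContDiffOn ℝ (1 : ℕ) (fderivWithin ℝ f Ω) Ω :=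
    hf.fderivWithin hΩ.uniqueDiffOn (by norm_cast)
  have hL₁ : ‖fderivWithin ℝ f Ω (θ₁ v) - L‖ ≤ η * R := by
    have hconv : Convex ℝ (({v.1} : Set E) ×ˢ (univ : Set X)) :=
      (convex_singleton _).prod convex_univ
    have hsub : (({v.1} : Set E) ×ˢ (univ : Set X)) ⊆ Ω := by
      rintro ⟨a, b⟩ ⟨ha, _⟩
      have ha' : a = v.1 := ha
      change a ∈ S
      rw [ha']
      exact hv
    have := hconv.norm_image_sub_le_of_norm_hasFDerivWithin_le (f := fderivWithin ℝ f Ω)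
      (f' := fderivWithin ℝ (fderivWithin ℝ f Ω) Ω) (C := η) (x := θ₀ v) (y := θ₁ v)
      (fun u hu => (((hfd u (hsub hu)).differentiableWithinAt
        (by norm_num)).hasFDerivWithinAt.mono hsub)) (fun u hu => ?_) (by simp [hθ₀'])
      (by simp [hθ₁'])
    · refine this.trans (mul_le_mul_of_nonneg_left ?_ hη0)
      rw [hθ₀', hθ₁']
      simpa using hvR
    · rw [← norm_iteratedFDerivWithin_one _ (hΩ.uniqueDiffOn _ (hsub hu)),
        norm_iteratedFDerivWithin_fderivWithin hΩ.uniqueDiffOn (hsub hu)]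
      exact hη 2 le_rfl hn u (hsub hu)
  have hLinr : ‖L.comp (ContinuousLinearMap.inr ℝ E X)‖ ≤ c := by
    have hmem := hm₀ hv
    rw [hL, fderivWithin_of_isOpen hΩ hmem]
    refine norm_fderiv_comp_inr_le hc
      ((hf.contDiffAt (hΩ.mem_nhds hmem)).differentiableAt (by norm_cast; omega))
      (hΩ.mem_nhds hmem) fun l u w hu _ => hlip l hu u w
  have b₁ := norm_iteratedFDerivWithin_sub_clm_comp_le hΩ hΩ hi1 hi hf hθ₁c hm₁ L hv hL₁
    (fun j hj2 hj => (hη j hj2 hj _ (hm₁ hv)).trans hηR)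
    (fun j hj1 hj => norm_iteratedFDerivWithin_clm_add_graph_le hS hj1 hj hy l₁ hl₁n hv hM
      (hyM j hj1 hj))
  have b₀ := norm_iteratedFDerivWithin_sub_clm_comp_le hΩ hΩ hi1 hi hf hθ₀c hm₀ L hv
    (η := η * R) (by rw [← hL, sub_self, norm_zero]; positivity)
    (fun j hj2 hj => (hη j hj2 hj _ (hm₀ hv)).trans hηR)
    (fun j hj1 hj => norm_iteratedFDerivWithin_clm_add_graph_le hS hj1 hj hy l₀ hl₀n hv hM
      (hyM j hj1 hj))
  set Q : E × X →L[ℝ] X :=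
    (L.comp (ContinuousLinearMap.inr ℝ E X)).comp (ContinuousLinearMap.snd ℝ E X) with hQ
  have hQn : ‖Q‖ ≤ c := (ContinuousLinearMap.opNorm_comp_le _ _).trans
    ((mul_le_of_le_one_right (norm_nonneg _) (ContinuousLinearMap.norm_snd_le ..)).trans hLinr)
  have hdec : (fun p : E × X => f (p.1, y p.1 + p.2) - f (p.1, y p.1))
      = fun p => ((f (θ₁ p) - L (θ₁ p)) - (f (θ₀ p) - L (θ₀ p))) + Q p := by
    funext p
    have : Q p = L (θ₁ p) - L (θ₀ p) := by
      rw [← map_sub, hθ₀', hθ₁']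
      simp [hQ]
    rw [this, ← hθ₀' p, ← hθ₁' p]
    abel
  have c₁ : ContDiffOn ℝ n (fun p => f (θ₁ p) - L (θ₁ p)) Ω :=
    (hf.comp hθ₁c hm₁).sub (L.contDiff.comp_contDiffOn hθ₁c)
  have c₀ : ContDiffOn ℝ n (fun p => f (θ₀ p) - L (θ₀ p)) Ω :=
    (hf.comp hθ₀c hm₀).sub (L.contDiff.comp_contDiffOn hθ₀c)
  rw [hdec, two_mul]
  exact norm_iteratedFDerivWithin_add_le hΩ hi (c₁.sub c₀) Q.contDiff.contDiffOn hv
    (norm_iteratedFDerivWithin_sub_le' hΩ hi c₁ c₀ hv b₁ b₀)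
    ((norm_iteratedFDerivWithin_clm_le Q hΩ hi1 hv).trans hQn)


/-- Derivative bounds for the nonlinearity `ξ ↦ f(y + ξ) + L y - y'` which governs the distance to
an approximate solution `y`. -/
theorem norm_iteratedFDerivWithin_residual_le {f : E × X → X} {y y' : E → X} {S : Set E}
    (hS : IsOpen S) {n i : ℕ} (hn : 2 ≤ n) (hi : i ≤ n)
    (hf : ContDiffOn ℝ n f (Prod.fst ⁻¹' S)) (hy : ContDiffOn ℝ n y S) (hy' : ContDiffOn ℝ n y' S)
    (L : X →L[ℝ] X) {C e c M R : ℝ} (hC : 0 ≤ C) (he : 0 ≤ e)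
    (hη : ∀ j, 2 ≤ j → j ≤ n → ∀ p : E × X, p.1 ∈ S →
      ‖iteratedFDerivWithin ℝ j f (Prod.fst ⁻¹' S) p‖ ≤ C * e)
    (hc : 0 ≤ c) (hlip : ∀ l ∈ S, ∀ u v, ‖f (l, u) - f (l, v)‖ ≤ c * ‖u - v‖)
    (hres₀ : ∀ l ∈ S, ‖y' l - L (y l) - f (l, y l)‖ ≤ e)
    (hres : ∀ j, 1 ≤ j → j ≤ n → ∀ l ∈ S,
      ‖iteratedFDerivWithin ℝ j y' S l
        - L.compContinuousMultilinearMap (iteratedFDerivWithin ℝ j y S l)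
        - iteratedFDerivWithin ℝ j (fun l => f (l, y l)) S l‖ ≤ C * e)
    {v : E × X} (hv : v.1 ∈ S) (hM : 0 ≤ M)
    (hyM : ∀ j, 1 ≤ j → j ≤ n → ‖iteratedFDerivWithin ℝ j y S v.1‖ ≤ M) (hR : 1 ≤ R)
    (hvR : ‖v.2‖ ≤ R) :
    ‖iteratedFDerivWithin ℝ i (fun p : E × X => f (p.1, y p.1 + p.2) + L (y p.1) - y' p.1)
      (Prod.fst ⁻¹' S) v‖
      ≤ (R + 1 + C + 2 * (n.factorial * (C * R) * (1 + M) ^ n)) * (c + e) := by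
  have hQ : 0 ≤ 2 * (n.factorial * (C * R) * (1 + M) ^ n) := by positivity
  have hR0 : 0 ≤ R := by linarith
  rcases Nat.eq_zero_or_pos i with rfl | hi1
  · rw [norm_iteratedFDerivWithin_zero]
    have h1 := hlip v.1 hv (y v.1 + v.2) (y v.1)
    rw [add_sub_cancel_left] at h1
    have h2 := hres₀ v.1 hv
    have h3 : f (v.1, y v.1 + v.2) + L (y v.1) - y' v.1 = (f (v.1, y v.1 + v.2) - f (v.1, y v.1))
        - (y' v.1 - L (y v.1) - f (v.1, y v.1)) := by abel
    have h4 := norm_sub_le (f (v.1, y v.1 + v.2) - f (v.1, y v.1))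
      (y' v.1 - L (y v.1) - f (v.1, y v.1))
    rw [← h3] at h4
    have h5 := mul_le_mul_of_nonneg_left hvR hc
    nlinarith [mul_nonneg hQ (add_nonneg hc he), mul_nonneg hC (add_nonneg hc he),
      mul_nonneg hR0 he]
  · have hΩ : IsOpen ((Prod.fst : E × X → E) ⁻¹' S) := hS.preimage continuous_fst
    have hfy : ContDiffOn ℝ n (fun l => f (l, y l)) S :=
      hf.comp (contDiffOn_id.prodMk hy) fun l hl => hl
    have hLy : ContDiffOn ℝ n (L ∘ y) S := L.contDiff.comp_contDiffOn hy
    have hyL : ContDiffOn ℝ n (y' - L ∘ y) S := hy'.sub hLy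
    set r : E → X := fun l => y' l - L (y l) - f (l, y l) with hr
    have hrc : ContDiffOn ℝ n r S := hyL.sub hfy
    have hrb : ‖iteratedFDerivWithin ℝ i r S v.1‖ ≤ C * e := by
      have hi' : (i : WithTop ℕ∞) ≤ n := by exact_mod_cast hi
      have e1 : iteratedFDerivWithin ℝ i r S v.1
          = iteratedFDerivWithin ℝ i y' S v.1
            - L.compContinuousMultilinearMap (iteratedFDerivWithin ℝ i y S v.1)
            - iteratedFDerivWithin ℝ i (fun l => f (l, y l)) S v.1 := by
        change iteratedFDerivWithin ℝ i ((y' - L ∘ y) - fun l => f (l, y l)) S v.1 = _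
        rw [iteratedFDerivWithin_sub_apply ((hyL _ hv).of_le hi')
          ((hfy _ hv).of_le hi') hS.uniqueDiffOn hv,
          iteratedFDerivWithin_sub_apply ((hy' _ hv).of_le hi') ((hLy _ hv).of_le hi')
          hS.uniqueDiffOn hv, L.iteratedFDerivWithin_comp_left (hy _ hv) hS.uniqueDiffOn hv hi']
      rw [e1]
      exact hres i hi1 hi v.1 hv
    have hrf : ContDiffOn ℝ n (fun p : E × X => r p.1) (Prod.fst ⁻¹' S) :=
      hrc.comp contDiffOn_fst fun _ hp => hp
    have b₂ : ‖iteratedFDerivWithin ℝ i (fun p : E × X => r p.1) (Prod.fst ⁻¹' S) v‖ ≤ C * e :=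
      (norm_iteratedFDerivWithin_comp_right_le hS hi hrc (ContinuousLinearMap.fst ℝ E X)
        (ContinuousLinearMap.norm_fst_le ..) hv).trans hrb
    have b₁ := norm_iteratedFDerivWithin_shift_sub_le hS hn hi1 hi hf hy hη hc hlip hv hM hyM hR hvR
    have hyf : ContDiffOn ℝ n (fun p : E × X => y p.1) (Prod.fst ⁻¹' S) :=
      hy.comp contDiffOn_fst fun _ hp => hp
    have hsh : ContDiffOn ℝ n (fun p : E × X => f (p.1, y p.1 + p.2) - f (p.1, y p.1))
        (Prod.fst ⁻¹' S) :=
      (hf.comp (contDiffOn_fst.prodMk (hyf.add contDiffOn_snd)) fun _ hp => hp).sub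
        (hf.comp (contDiffOn_fst.prodMk hyf) fun _ hp => hp)
    have hdec : (fun p : E × X => f (p.1, y p.1 + p.2) + L (y p.1) - y' p.1)
        = fun p => (f (p.1, y p.1 + p.2) - f (p.1, y p.1)) - r p.1 := by
      funext p
      simp only [hr]
      abel
    rw [hdec]
    refine (norm_iteratedFDerivWithin_sub_le' hΩ hi hsh hrf hv b₁ b₂).trans ?_
    have hfac : (i.factorial : ℝ) ≤ n.factorial := by exact_mod_cast Nat.factorial_le hi
    have hpow : (1 + M) ^ i ≤ (1 + M) ^ n := pow_le_pow_right₀ (by linarith) hi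
    have hmono : 2 * ((i.factorial : ℝ) * (C * e * R) * (1 + M) ^ i)
        ≤ 2 * (n.factorial * (C * e * R) * (1 + M) ^ n) := by gcongr
    have heq : 2 * ((n.factorial : ℝ) * (C * e * R) * (1 + M) ^ n)
        = 2 * (n.factorial * (C * R) * (1 + M) ^ n) * e := by ring
    nlinarith [mul_nonneg hQ hc, mul_nonneg hC hc, mul_nonneg hR0 (add_nonneg hc he)]

end DerivativeBounds

section Shadowing

/-- A pointwise contraction principle: a bounded family of functions satisfying an integral
inequality with contraction constant `q < 1` and vanishing perturbation tends to zero pointwise. -/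
theorem tendsto_zero_of_le_integral {ι : Type*} {l : Filter ι} [l.IsCountablyGenerated]
    {w : ℝ → ℝ → ℝ} (hw0 : ∀ t s, 0 ≤ w t s) (hwm : ∀ t, AEStronglyMeasurable (w t))
    {c m : ℝ → ℝ} (hcm : Measurable c) (hc0 : ∀ s, 0 ≤ c s)
    (hc : ∀ t, Integrable fun s => c s * w t s) {q K : ℝ} (hq0 : 0 ≤ q) (hq1 : q < 1)
    (hq : ∀ t, ∫ s, c s * w t s ≤ q) (hm : ∀ t, Integrable fun s => m s * w t s)
    {D ρ : ι → ℝ → ℝ}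
    (hD : ∀ᶠ i in l, Measurable (D i) ∧ Measurable (ρ i) ∧ (∀ s, 0 ≤ D i s) ∧ (∀ s, D i s ≤ K) ∧
      (∀ s, 0 ≤ ρ i s) ∧ (∀ s, ρ i s ≤ m s) ∧
      ∀ t, D i t ≤ ∫ s, (c s * D i s + ρ i s) * w t s)
    (hρ : ∀ s, Filter.Tendsto (fun i => ρ i s) l (𝓝 0)) (t : ℝ) :
    Filter.Tendsto (fun i => D i t) l (𝓝 0) := by
  rcases l.eq_or_neBot with rfl | hne
  · exact Filter.tendsto_bot
  obtain ⟨i₀, hi₀⟩ := hD.exists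
  have hK : 0 ≤ K := (hi₀.2.2.1 0).trans (hi₀.2.2.2.1 0)
  have key : ∀ j : ℕ, ∀ t, Filter.Tendsto (fun i => max (D i t - q ^ j * K) 0) l (𝓝 0) := by
    intro j
    induction j with
    | zero =>
      intro t
      refine tendsto_const_nhds.congr' ?_
      filter_upwards [hD] with i hi
      rw [pow_zero, one_mul, max_eq_right (sub_nonpos.2 (hi.2.2.2.1 t))]
    | succ j ih =>
      intro t
      set a := q ^ j * K with ha
      have ha0 : 0 ≤ a := by positivity
      have hI : Filter.Tendsto (fun i => ∫ s, (c s * max (D i s - a) 0 + ρ i s) * w t s) l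
          (𝓝 (∫ _ : ℝ, (0 : ℝ))) := by
        refine tendsto_integral_filter_of_dominated_convergence
          (fun s => K * (c s * w t s) + m s * w t s) ?_ ?_ (((hc t).const_mul K).add (hm t)) ?_
        · filter_upwards [hD] with i hi
          exact ((hcm.mul ((hi.1.sub_const a).max measurable_const)).add
            hi.2.1).aestronglyMeasurable.mul (hwm t)
        · filter_upwards [hD] with i hi
          refine Filter.Eventually.of_forall fun s => ?_
          have h1 : max (D i s - a) 0 ≤ K := max_le (by linarith [hi.2.2.2.1 s]) hK
          have h2 : 0 ≤ max (D i s - a) 0 := le_max_right _ _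
          have h3 := hi.2.2.2.2.1 s
          rw [Real.norm_of_nonneg (mul_nonneg (add_nonneg (mul_nonneg (hc0 s) h2) h3) (hw0 t s))]
          have := mul_le_mul_of_nonneg_right (add_le_add
            (mul_le_mul_of_nonneg_left h1 (hc0 s)) (hi.2.2.2.2.2.1 s)) (hw0 t s)
          linarith
        · refine Filter.Eventually.of_forall fun s => ?_
          have := (((ih s).const_mul (c s)).add (hρ s)).mul_const (w t s)
          simpa using this
      rw [integral_zero] at hI
      refine squeeze_zero' (Filter.Eventually.of_forall fun i => le_max_right _ _) ?_ hI
      filter_upwards [hD] with i hi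
      have hpos : ∀ s, 0 ≤ (c s * max (D i s - a) 0 + ρ i s) * w t s := fun s =>
        mul_nonneg (add_nonneg (mul_nonneg (hc0 s) (le_max_right _ _)) (hi.2.2.2.2.1 s)) (hw0 t s)
      refine max_le ?_ (integral_nonneg hpos)
      have hintegrable : Integrable fun s => (c s * max (D i s - a) 0 + ρ i s) * w t s := by
        refine (((hc t).const_mul K).add (hm t)).mono'
          (((hcm.mul ((hi.1.sub_const a).max measurable_const)).add
            hi.2.1).aestronglyMeasurable.mul (hwm t)) (Filter.Eventually.of_forall fun s => ?_)
        have h1 : max (D i s - a) 0 ≤ K := max_le (by linarith [hi.2.2.2.1 s]) hK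
        rw [Real.norm_of_nonneg (hpos s)]
        have := mul_le_mul_of_nonneg_right (add_le_add
          (mul_le_mul_of_nonneg_left h1 (hc0 s)) (hi.2.2.2.2.2.1 s)) (hw0 t s)
        simp only [Pi.add_apply]
        linarith
      have hle : ∫ s, (c s * D i s + ρ i s) * w t s
          ≤ ∫ s, ((c s * max (D i s - a) 0 + ρ i s) * w t s + a * (c s * w t s)) := by
        refine integral_mono_of_nonneg (Filter.Eventually.of_forall fun s => ?_)
          (hintegrable.add ((hc t).const_mul a)) (Filter.Eventually.of_forall fun s => ?_)
        · exact mul_nonneg (add_nonneg (mul_nonneg (hc0 s) (hi.2.2.1 s)) (hi.2.2.2.2.1 s)) (hw0 t s)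
        · have h1 : D i s ≤ max (D i s - a) 0 + a := by linarith [le_max_left (D i s - a) 0]
          have := mul_le_mul_of_nonneg_right (mul_le_mul_of_nonneg_left h1 (hc0 s)) (hw0 t s)
          simp only
          linarith
      rw [integral_add hintegrable ((hc t).const_mul a), integral_const_mul] at hle
      have h2 : a * ∫ s, c s * w t s ≤ a * q := mul_le_mul_of_nonneg_left (hq t) ha0
      have h3 : q ^ (j + 1) * K = a * q := by rw [ha]; ring
      linarith [hi.2.2.2.2.2.2 t]
  refine (tendsto_order.2 ⟨fun b hb => ?_, fun b hb => ?_⟩)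
  · filter_upwards [hD] with i hi using hb.trans_le (hi.2.2.1 t)
  · have hlim : Filter.Tendsto (fun j : ℕ => q ^ j * K) Filter.atTop (𝓝 0) := by
      simpa using (tendsto_pow_atTop_nhds_zero_of_lt_one hq0 hq1).mul_const K
    obtain ⟨j, hj⟩ := (hlim.eventually (gt_mem_nhds (half_pos hb))).exists
    filter_upwards [(key j t).eventually (gt_mem_nhds (half_pos hb))] with i hi
    have := le_max_left (D i t - q ^ j * K) 0
    linarith

variable {X : Type*} [NormedAddCommGroup X] [NormedSpace ℝ X] [CompleteSpace X]
  {A : ℝ → X →L[ℝ] X} {T : ℝ → ℝ → X →L[ℝ] X} {P : ℝ → X →L[ℝ] X} {G : ℝ → ℝ → X →L[ℝ] X}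

/-- If the homogeneous equation has no nonzero bounded solution, then a bounded solution of the
inhomogeneous equation is given by the Green function. -/
theorem IsGreenFunction.eq_integral (hT : IsEvolutionFamily A T) (hP : Continuous P)
    (hG : IsGreenFunction T P G)
    (hnb : ∀ x : ℝ → X, (∀ t, HasDerivAt x (A t (x t)) t) → (∃ M, ∀ t, ‖x t‖ ≤ M) → ∀ t, x t = 0)
    {z h : ℝ → X} (hz : ∀ t, HasDerivAt z (A t (z t) + h t) t) (hh : Continuous h) {K : ℝ}
    (hzK : ∀ t, ‖z t‖ ≤ K) {b : ℝ → ℝ} {B : ℝ} (hb : ∀ t, Integrable fun s => b s * ‖G t s‖)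
    (hB : ∀ t, ∫ s, b s * ‖G t s‖ ≤ B) (hhb : ∀ s, ‖h s‖ ≤ b s) (t : ℝ) :
    z t = ∫ s, G t s (h s) := by
  have h0 := hG.integrable_apply hT hP hh.stronglyMeasurable (hb 0) hhb
  refine sub_eq_zero.1 (hnb (fun t => z t - ∫ s, G t s (h s)) (fun t => ?_)
    ⟨K + B, fun t => ?_⟩ t)
  · have := (hz t).sub (hG.hasDerivAt_integral hT hh h0 t)
    rw [add_sub_add_right_eq_sub, ← map_sub] at this
    exact this
  · exact (norm_sub_le _ _).trans
      (add_le_add (hzK t) ((norm_integral_green_le (hb t) hhb).trans (hB t)))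

/-- Bounded solutions of a parameterized contractive nonlinear perturbation of a linear equation
depend continuously on the parameter. -/
theorem continuousOn_of_bounded_solution {E : Type*} [TopologicalSpace E]
    [FirstCountableTopology E] {S : Set E} {g : E → ℝ → X → X} {z : E → ℝ → X} {c eps : ℝ → ℝ}
    {q L R : ℝ} (hT : IsEvolutionFamily A T) (hP : Continuous P)
    (hG : IsGreenFunction T P G)
    (hnb : ∀ x : ℝ → X, (∀ t, HasDerivAt x (A t (x t)) t) → (∃ M, ∀ t, ‖x t‖ ≤ M) → ∀ t, x t = 0)
    (hc : Continuous c) (hc0 : ∀ s, 0 ≤ c s) (hq1 : q < 1)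
    (hqint : ∀ t, Integrable fun s => c s * ‖G t s‖) (hq : ∀ t, ∫ s, c s * ‖G t s‖ ≤ q)
    (heps0 : ∀ s, 0 ≤ eps s)
    (hLint : ∀ t, Integrable fun s => eps s * ‖G t s‖) (hL : ∀ t, ∫ s, eps s * ‖G t s‖ ≤ L)
    (hgc : ∀ l ∈ S, Continuous fun p : ℝ × X => g l p.1 p.2)
    (hglip : ∀ l ∈ S, ∀ s u v, ‖g l s u - g l s v‖ ≤ c s * ‖u - v‖)
    (hg0 : ∀ l ∈ S, ∀ s, ‖g l s 0‖ ≤ eps s)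
    (hz : ∀ l ∈ S, ∀ t, HasDerivAt (z l) (A t (z l t) + g l t (z l t)) t)
    (hzR : ∀ l ∈ S, ∀ t, ‖z l t‖ ≤ R)
    (hgl : ∀ s u, ContinuousOn (fun l => g l s u) S) (t : ℝ) :
    ContinuousOn (fun l => z l t) S := by
  intro μ hμ
  have hR : 0 ≤ R := (norm_nonneg _).trans (hzR μ hμ 0)
  have hgR : ∀ l ∈ S, ∀ s u, ‖u‖ ≤ R → ‖g l s u‖ ≤ R * c s + eps s := by
    intro l hl s u hu
    have h1 := hglip l hl s u 0
    have h2 := norm_add_le (g l s u - g l s 0) (g l s 0)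
    rw [sub_add_cancel] at h2
    rw [sub_zero] at h1
    nlinarith [hg0 l hl s, mul_le_mul_of_nonneg_left hu (hc0 s)]
  have hb : ∀ t, Integrable fun s => (R * c s + eps s) * ‖G t s‖ := fun t => by
    refine (((hqint t).const_mul R).add (hLint t)).congr (Filter.Eventually.of_forall fun s => ?_)
    simp only [Pi.add_apply]
    ring
  have hB : ∀ t, ∫ s, (R * c s + eps s) * ‖G t s‖ ≤ R * q + L := fun t => by
    have : (fun s => (R * c s + eps s) * ‖G t s‖)
        = fun s => R * (c s * ‖G t s‖) + eps s * ‖G t s‖ := by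
      funext s; ring
    rw [this, integral_add ((hqint t).const_mul R) (hLint t), integral_const_mul]
    exact add_le_add (mul_le_mul_of_nonneg_left (hq t) hR) (hL t)
  have hzc : ∀ l ∈ S, Continuous (z l) := fun l hl =>
    continuous_iff_continuousAt.2 fun t => (hz l hl t).continuousAt
  have hgz : ∀ l ∈ S, ∀ l' ∈ S, Continuous fun s => g l s (z l' s) := fun l hl l' hl' =>
    (hgc l hl).comp (continuous_id.prodMk (hzc l' hl'))
  have hfix : ∀ l ∈ S, ∀ t, z l t = ∫ s, G t s (g l s (z l s)) := fun l hl t =>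
    hG.eq_integral hT hP hnb (hz l hl) (hgz l hl l hl) (hzR l hl) hb hB
      (fun s => hgR l hl s _ (hzR l hl s)) t
  have hq0 : 0 ≤ q := (integral_nonneg fun s => mul_nonneg (hc0 s) (norm_nonneg _)).trans (hq 0)
  rw [ContinuousWithinAt, tendsto_iff_norm_sub_tendsto_zero]
  refine tendsto_zero_of_le_integral (w := fun t s => ‖G t s‖) (fun t s => norm_nonneg _)
    (fun t => (hG.stronglyMeasurable hT hP t).norm.aestronglyMeasurable) hc.measurable hc0 hqint
    hq0 hq1 hq (K := 2 * R) (m := fun s => 2 * (R * c s + eps s)) (fun t => ?_)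
    (D := fun l t => ‖z l t - z μ t‖) (ρ := fun l s => ‖g l s (z μ s) - g μ s (z μ s)‖) ?_
    (fun s => ?_) t
  · simpa only [mul_assoc] using (hb t).const_mul 2
  · filter_upwards [self_mem_nhdsWithin] with l hl
    refine ⟨((hzc l hl).sub (hzc μ hμ)).norm.measurable,
      ((hgz l hl μ hμ).sub (hgz μ hμ μ hμ)).norm.measurable, fun s => norm_nonneg _,
      fun s => (norm_sub_le _ _).trans ?_, fun s => norm_nonneg _,
      fun s => (norm_sub_le _ _).trans ?_, fun t => ?_⟩
    · linarith [hzR l hl s, hzR μ hμ s]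
    · linarith [hgR l hl s _ (hzR μ hμ s), hgR μ hμ s _ (hzR μ hμ s)]
    · have hi : ∀ l ∈ S, Integrable fun s => G t s (g l s (z l s)) := fun l hl =>
        hG.integrable_apply hT hP (hgz l hl l hl).stronglyMeasurable (hb t)
          fun s => hgR l hl s _ (hzR l hl s)
      rw [hfix l hl t, hfix μ hμ t, ← integral_sub (hi l hl) (hi μ hμ)]
      simp_rw [← map_sub]
      refine norm_integral_green_le ?_ fun s => ?_
      · refine ((hb t).const_mul 4).mono' ?_ (Filter.Eventually.of_forall fun s => ?_)
        · exact (((hc.mul ((hzc l hl).sub (hzc μ hμ)).norm).add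
            ((hgz l hl μ hμ).sub (hgz μ hμ μ hμ)).norm).measurable.aestronglyMeasurable).mul
            (hG.stronglyMeasurable hT hP t).norm.aestronglyMeasurable
        · have h1 : ‖z l s - z μ s‖ ≤ 2 * R := (norm_sub_le _ _).trans
            (by linarith [hzR l hl s, hzR μ hμ s])
          have h2 : ‖g l s (z μ s) - g μ s (z μ s)‖ ≤ 2 * (R * c s + eps s) :=
            (norm_sub_le _ _).trans
              (by linarith [hgR l hl s _ (hzR μ hμ s), hgR μ hμ s _ (hzR μ hμ s)])
          have h3 := mul_le_mul_of_nonneg_left h1 (hc0 s)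
          rw [Real.norm_of_nonneg (mul_nonneg (add_nonneg (mul_nonneg (hc0 s) (norm_nonneg _))
            (norm_nonneg _)) (norm_nonneg _)), ← mul_assoc]
          refine mul_le_mul_of_nonneg_right ?_ (norm_nonneg _)
          linarith [heps0 s]
      · have := norm_add_le (g l s (z l s) - g l s (z μ s)) (g l s (z μ s) - g μ s (z μ s))
        rw [sub_add_sub_cancel] at this
        exact this.trans (add_le_add_left (hglip l hl s _ _) _)
  · have := (tendsto_iff_norm_sub_tendsto_zero.1 (hgl s (z μ s) μ hμ))
    exact this

/-- Bounded solutions of a parameterized contractive nonlinear perturbation of a linear equation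
depend smoothly on the parameter. -/
theorem contDiffOn_of_bounded_solution {E : Type*} [NormedAddCommGroup E] [NormedSpace ℝ E]
    {S : Set E} {g : E → ℝ → X → X} {z : E → ℝ → X} {c eps : ℝ → ℝ}
    {q L R₀ R K : ℝ} (hT : IsEvolutionFamily A T) (hP : Continuous P)
    (hG : IsGreenFunction T P G)
    (hnb : ∀ x : ℝ → X, (∀ t, HasDerivAt x (A t (x t)) t) → (∃ M, ∀ t, ‖x t‖ ≤ M) → ∀ t, x t = 0)
    (hc : Continuous c) (hc0 : ∀ s, 0 ≤ c s) (hq1 : q < 1)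
    (hqint : ∀ t, Integrable fun s => c s * ‖G t s‖) (hq : ∀ t, ∫ s, c s * ‖G t s‖ ≤ q)
    (heps : Continuous eps) (heps0 : ∀ s, 0 ≤ eps s)
    (hLint : ∀ t, Integrable fun s => eps s * ‖G t s‖) (hL : ∀ t, ∫ s, eps s * ‖G t s‖ ≤ L)
    (hS : IsOpen S) (hSc : Convex ℝ S)
    (hgc : ∀ l ∈ S, Continuous fun p : ℝ × X => g l p.1 p.2)
    (hglip : ∀ l ∈ S, ∀ s u v, ‖g l s u - g l s v‖ ≤ c s * ‖u - v‖)
    (hz : ∀ l ∈ S, ∀ t, HasDerivAt (z l) (A t (z l t) + g l t (z l t)) t)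
    (hzR : ∀ l ∈ S, ∀ t, ‖z l t‖ ≤ R₀) (hR : R₀ < R) {n : ℕ} (hn : 1 ≤ n)
    (hgC : ∀ s, ContDiffOn ℝ ((n + 1 : ℕ) : WithTop ℕ∞) (fun p : E × X => g p.1 s p.2)
      (Prod.fst ⁻¹' S)) (hK : 0 ≤ K)
    (hgb : ∀ i ≤ n + 1, ∀ s, ∀ p : E × X, p.1 ∈ S → ‖p.2‖ ≤ R →
      ‖iteratedFDerivWithin ℝ i (fun p : E × X => g p.1 s p.2) (Prod.fst ⁻¹' S) p‖
        ≤ K * (c s + eps s)) (t : ℝ) :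
    ContDiffOn ℝ n (fun l => z l t) S := by
  rcases S.eq_empty_or_nonempty with rfl | ⟨μ, hμ⟩
  · exact fun _ h => h.elim
  have hq0 : 0 ≤ q := (integral_nonneg fun s => mul_nonneg (hc0 s) (norm_nonneg _)).trans (hq 0)
  have hR0 : 0 < R := ((norm_nonneg _).trans (hzR μ hμ 0)).trans_lt hR
  set m : ℝ → ℝ := fun s => c s + eps s with hm
  have hm0 : ∀ s, 0 ≤ m s := fun s => add_nonneg (hc0 s) (heps0 s)
  have hmint : ∀ t, Integrable fun s => m s * ‖G t s‖ := fun t => by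
    simp only [hm, add_mul]
    exact (hqint t).add (hLint t)
  have hmB : ∀ t, ∫ s, m s * ‖G t s‖ ≤ q + L := fun t => by
    simp only [hm, add_mul]
    rw [integral_add (hqint t) (hLint t)]
    exact add_le_add (hq t) (hL t)
  have hB : 0 ≤ q + L :=
    (integral_nonneg fun s => mul_nonneg (hm0 s) (norm_nonneg _)).trans (hmB 0)
  have hgK : ∀ l ∈ S, ∀ s u, ‖u‖ ≤ R → ‖g l s u‖ ≤ K * m s := fun l hl s u hu => by
    simpa using hgb 0 (Nat.zero_le _) s (l, u) hl hu
  obtain ⟨Λ, hΛ, hΛB⟩ := hG.exists_linearMap hT hP (hc.add heps) hm0 hmint hmB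
  set W : Set (E × (ℝ →ᵇ X)) := S ×ˢ Metric.ball 0 R with hW
  have hWo : IsOpen W := hS.prod Metric.isOpen_ball
  set φ : ℝ → E × (ℝ →ᵇ X) → X := fun s v => g v.1 s (v.2 s) with hφ
  have hvR : ∀ v ∈ W, ∀ s, ‖v.2 s‖ ≤ R := fun v hv s =>
    (v.2.norm_coe_le_norm s).trans (by simpa using hv.2.le)
  have hmem : ∀ v ∈ W, (fun s => φ s v) ∈ weightedBounded X m := fun v hv =>
    ⟨((hgc v.1 hv.1).comp (continuous_id.prodMk v.2.continuous)).stronglyMeasurable, K,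
      fun s => hgK v.1 hv.1 s _ (hvR v hv s)⟩
  classical
  set F : E × (ℝ →ᵇ X) → (ℝ →ᵇ X) := fun v => if hv : v ∈ W then Λ ⟨_, hmem v hv⟩ else 0 with hF
  have hFW : ∀ v (hv : v ∈ W), F v = Λ ⟨_, hmem v hv⟩ := fun v hv => by simp only [hF, dif_pos hv]
  have hFt : ∀ v ∈ W, ∀ t, F v t = ∫ s, G t s (φ s v) := fun v hv t => by
    rw [hFW v hv, hΛ]
  set ev : ℝ → E × (ℝ →ᵇ X) →L[ℝ] E × X := fun s =>
    (ContinuousLinearMap.fst ℝ E (ℝ →ᵇ X)).prod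
      ((BoundedContinuousFunction.evalCLM ℝ s).comp (ContinuousLinearMap.snd ℝ E (ℝ →ᵇ X)))
    with hev
  have hevn : ∀ s, ‖ev s‖ ≤ 1 := fun s =>
    ContinuousLinearMap.opNorm_le_bound _ zero_le_one fun v => by
      rw [one_mul]
      exact max_le (le_max_left _ _) ((v.2.norm_coe_le_norm s).trans (le_max_right _ _))
  have hSo : IsOpen ((Prod.fst : E × X → E) ⁻¹' S) := hS.preimage continuous_fst
  have hFC : ContDiffOn ℝ n F W := by
    refine contDiffOn_of_forall_norm_iteratedFDerivWithin_le Λ hB hΛB hWo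
      (hSc.prod (convex_ball _ _)) (φ := φ) (fun s => ?_) hK (fun i hi s v hv => ?_)
      (fun v hv => (hmem v hv).1) fun v hv h hh => ?_
    · exact (hgC s).comp (ev s).contDiff.contDiffOn fun v hv => hv.1
    · have h1 := norm_iteratedFDerivWithin_comp_right_le hSo hi (hgC s) (ev s) (hevn s)
        (v := v) hv.1
      have h2 : iteratedFDerivWithin ℝ i (φ s) W v
          = iteratedFDerivWithin ℝ i (φ s) (ev s ⁻¹' (Prod.fst ⁻¹' S)) v :=
        (iteratedFDerivWithin_of_isOpen i hWo hv).trans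
          (iteratedFDerivWithin_of_isOpen i (hSo.preimage (ev s).continuous) hv.1).symm
      rw [h2]
      exact h1.trans (hgb i hi s _ hv.1 (hvR v hv s))
    · rw [hFW v hv]
      congr 1
      ext s
      exact (hh s).symm
  have hzc : ∀ l ∈ S, Continuous (z l) := fun l hl =>
    continuous_iff_continuousAt.2 fun t => (hz l hl t).continuousAt
  set Z : E → (ℝ →ᵇ X) := fun l =>
    if hl : l ∈ S then BoundedContinuousFunction.ofNormedAddCommGroup (z l) (hzc l hl) R₀ (hzR l hl)
    else 0 with hZ
  have hZt : ∀ l ∈ S, ∀ t, Z l t = z l t := fun l hl t => by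
    simp only [hZ, dif_pos hl, BoundedContinuousFunction.coe_ofNormedAddCommGroup]
  have hZm : MapsTo Z S (Metric.ball 0 R) := fun l hl => by
    rw [mem_ball_zero_iff]
    refine lt_of_le_of_lt ?_ hR
    refine (BoundedContinuousFunction.norm_le ((norm_nonneg _).trans (hzR l hl 0))).2 fun t => ?_
    rw [hZt l hl]
    exact hzR l hl t
  have hφi : ∀ v ∈ W, ∀ t, Integrable fun s => G t s (φ s v) := fun v hv t =>
    hG.integrable_apply hT hP (hmem v hv).1 (b := fun s => K * m s)
      (by simpa only [mul_assoc] using (hmint t).const_mul K)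
      fun s => hgK v.1 hv.1 s _ (hvR v hv s)
  have hlip : ∀ l ∈ S, ∀ u ∈ Metric.ball (0 : ℝ →ᵇ X) R, ∀ v ∈ Metric.ball (0 : ℝ →ᵇ X) R,
      ‖F (l, u) - F (l, v)‖ ≤ q * ‖u - v‖ := by
    intro l hl u hu v hv
    refine (BoundedContinuousFunction.norm_le (mul_nonneg hq0 (norm_nonneg _))).2 fun t => ?_
    have hlu : (l, u) ∈ W := ⟨hl, hu⟩
    have hlv : (l, v) ∈ W := ⟨hl, hv⟩
    rw [BoundedContinuousFunction.sub_apply, hFt _ hlu, hFt _ hlv,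
      ← integral_sub (hφi _ hlu t) (hφi _ hlv t)]
    simp_rw [← map_sub]
    have e : ∀ s, ‖u - v‖ * (c s * ‖G t s‖) = c s * ‖u - v‖ * ‖G t s‖ := fun s => by ring
    have hi := (hqint t).const_mul ‖u - v‖
    simp_rw [e] at hi
    refine (norm_integral_green_le hi fun s => ?_).trans ?_
    · exact (hglip l hl s _ _).trans
        (mul_le_mul_of_nonneg_left ((u - v).norm_coe_le_norm s) (hc0 s))
    · simp_rw [← e]
      rw [integral_const_mul, mul_comm]
      exact mul_le_mul_of_nonneg_right (hq t) (norm_nonneg _)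
  have hfix : ∀ l ∈ S, F (l, Z l) = Z l := by
    intro l hl
    ext t
    rw [hFt _ ⟨hl, hZm hl⟩, hZt l hl]
    have hgz : Continuous fun s => g l s (z l s) :=
      (hgc l hl).comp (continuous_id.prodMk (hzc l hl))
    have := hG.eq_integral hT hP hnb (hz l hl) hgz (hzR l hl) (b := fun s => K * m s)
      (B := K * (q + L)) (fun t => by simpa only [mul_assoc] using (hmint t).const_mul K)
      (fun t => by
        simp only [mul_assoc]
        rw [integral_const_mul]
        exact mul_le_mul_of_nonneg_left (hmB t) hK)
      (fun s => hgK l hl s _ ((hzR l hl s).trans hR.le)) t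
    rw [this]
    simp only [hφ, hZt l hl]
  have hZC := contDiffOn_fixedPoint hS Metric.isOpen_ball hn hFC hq0 hq1 hlip hZm hfix
  refine ((BoundedContinuousFunction.evalCLM ℝ t).contDiff.comp_contDiffOn hZC).congr
    fun l hl => ?_
  exact (hZt l hl t).symm

end Shadowing

/-- Theorem: `C^k` parameterized shadowing. Under the assumptions of
the shadowing theorem, if moreover the regularity conditions (R1) (joint `C^{k+1}`
regularity of `f` with derivative bounds `Cε(t)`) and (R2) (`C^{k+1}` regularity of
`λ ↦ y_λ(t)`, `λ ↦ y_λ'(t)` with the corresponding bounds) hold, then for each `t ∈ ℝ`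
the map `λ ↦ x_λ(t)` is `C^k` on `Σ`. -/
theorem stmt6
    {X : Type*} [NormedAddCommGroup X] [NormedSpace ℝ X] [CompleteSpace X]
    {E : Type*} [NormedAddCommGroup E] [NormedSpace ℝ E]
    (A : ℝ → X →L[ℝ] X) (hA : Continuous A)
    (T : ℝ → ℝ → X →L[ℝ] X)
    (hTid : ∀ s, T s s = 1)
    (hT : ∀ s t, HasDerivAt (fun r => T r s) ((A t).comp (T t s)) t)
    (P : ℝ → X →L[ℝ] X) (hP : Continuous P)
    (G : ℝ → ℝ → X →L[ℝ] X)
    (hG : ∀ t s, G t s = if s ≤ t then (T t s).comp (P s)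
      else -((T t s).comp (1 - P s)))
    (Sg : Set E) (hSg : IsOpen Sg) (hSgne : Sg.Nonempty)
    (f : E → ℝ → X → X)
    (hf : ∀ lam ∈ Sg, Continuous (fun p : ℝ × X => f lam p.1 p.2))
    (c : ℝ → ℝ) (hc : Continuous c) (hc0 : ∀ t, 0 ≤ c t)
    (hlip : ∀ lam ∈ Sg, ∀ t (x₁ x₂ : X),
      ‖f lam t x₁ - f lam t x₂‖ ≤ c t * ‖x₁ - x₂‖)
    (q : ℝ) (hq1 : q < 1)
    (hqint : ∀ t, Integrable (fun s => c s * ‖G t s‖))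
    (hq : ∀ t, (∫ s, c s * ‖G t s‖) ≤ q)
    (eps : ℝ → ℝ) (heps : Continuous eps) (heps0 : ∀ t, 0 < eps t)
    (L : ℝ)
    (hLint : ∀ t, Integrable (fun s => eps s * ‖G t s‖))
    (hL : ∀ t, (∫ s, eps s * ‖G t s‖) ≤ L)
    (hnb : ∀ x : ℝ → X, (∀ t, HasDerivAt x (A t (x t)) t) →
      (∃ M, ∀ t, ‖x t‖ ≤ M) → ∀ t, x t = 0)
    -- the approximate solutions y_λ
    (y : E → ℝ → X) (y' : E → ℝ → X)
    (hy : ∀ lam ∈ Sg, ∀ t, HasDerivAt (y lam) (y' lam t) t)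
    (hy'c : ∀ lam ∈ Sg, Continuous (y' lam))
    (hpse : ∀ lam ∈ Sg, ∀ t,
      ‖y' lam t - A t (y lam t) - f lam t (y lam t)‖ ≤ eps t)
    -- the shadowing solutions x_λ from Theorem PR
    (x : E → ℝ → X)
    (hxsol : ∀ lam ∈ Sg, ∀ t, HasDerivAt (x lam) (A t (x lam t) + f lam t (x lam t)) t)
    (hxshad : ∀ lam ∈ Sg, ∀ t, ‖x lam t - y lam t‖ ≤ L / (1 - q))
    (k : ℕ) (C : ℝ) (hC : 0 < C)
    -- (R1): (λ,x) ↦ f_λ(t,x) is C^{k+1} with all mixed partial derivatives of order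
    -- 2 ≤ i ≤ k+1 bounded by Cε(t)
    (hfC : ∀ t, ContDiffOn ℝ ((k : ℕ∞) + 1) (fun p : E × X => f p.1 t p.2) (Sg ×ˢ univ))
    (hfbound : ∀ i : ℕ, 2 ≤ i → i ≤ k + 1 → ∀ t : ℝ, ∀ lam ∈ Sg, ∀ ξ : X,
      ‖iteratedFDerivWithin ℝ i (fun p : E × X => f p.1 t p.2) (Sg ×ˢ univ) (lam, ξ)‖
        ≤ C * eps t)
    -- (R2): λ ↦ y_λ(t) and λ ↦ y_λ'(t) are C^{k+1} with
    -- ‖∂^i_λ y_λ'(t) − A(t)∂^i_λ y_λ(t) − d^i/dλ^i f_λ(t,y_λ(t))‖ ≤ Cε(t)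
    (hyC : ∀ t, ContDiffOn ℝ ((k : ℕ∞) + 1) (fun lam => y lam t) Sg)
    (hy'C : ∀ t, ContDiffOn ℝ ((k : ℕ∞) + 1) (fun lam => y' lam t) Sg)
    (hR2 : ∀ i : ℕ, 1 ≤ i → i ≤ k + 1 → ∀ t : ℝ, ∀ lam ∈ Sg,
      ‖iteratedFDerivWithin ℝ i (fun mu => y' mu t) Sg lam
        - (A t).compContinuousMultilinearMap
            (iteratedFDerivWithin ℝ i (fun mu => y mu t) Sg lam)
        - iteratedFDerivWithin ℝ i (fun mu => f mu t (y mu t)) Sg lam‖ ≤ C * eps t)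
    -- local uniform bounds on the λ-derivatives of y
    (hM : ∀ lam₀ ∈ Sg, ∃ M : ℝ, 1 < M ∧ ∃ S₀ ∈ nhds lam₀, S₀ ⊆ Sg ∧
      ∀ lam ∈ S₀, ∀ i : ℕ, 1 ≤ i → i ≤ k + 1 → ∀ t : ℝ,
        ‖iteratedFDerivWithin ℝ i (fun mu => y mu t) Sg lam‖ ≤ M) :
    ∀ t : ℝ, ContDiffOn ℝ (k : ℕ∞) (fun lam => x lam t) Sg := by
  have hTe : IsEvolutionFamily A T := ⟨hA, hTid, hT⟩
  have hGr : IsGreenFunction T P G := hG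
  obtain ⟨μ, hμ⟩ := hSgne
  set R₀ : ℝ := L / (1 - q) with hR₀
  have hR₀0 : 0 ≤ R₀ := (norm_nonneg _).trans (hxshad μ hμ 0)
  set g : E → ℝ → X → X := fun l s ξ => f l s (y l s + ξ) + A s (y l s) - y' l s with hg
  set z : E → ℝ → X := fun l s => x l s - y l s with hz
  have hyc : ∀ l ∈ Sg, Continuous (y l) := fun l hl =>
    continuous_iff_continuousAt.2 fun t => (hy l hl t).continuousAt
  have hgc : ∀ l ∈ Sg, Continuous fun p : ℝ × X => g l p.1 p.2 := fun l hl => by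
    have hy1 : Continuous fun p : ℝ × X => y l p.1 := (hyc l hl).comp continuous_fst
    exact (((hf l hl).comp (continuous_fst.prodMk (hy1.add continuous_snd))).add
      ((hA.comp continuous_fst).clm_apply hy1)).sub ((hy'c l hl).comp continuous_fst)
  have hglip : ∀ l ∈ Sg, ∀ s u v, ‖g l s u - g l s v‖ ≤ c s * ‖u - v‖ := fun l hl s u v => by
    have := hlip l hl s (y l s + u) (y l s + v)
    rw [add_sub_add_left_eq_sub] at this
    change ‖f l s (y l s + u) + A s (y l s) - y' l s
      - (f l s (y l s + v) + A s (y l s) - y' l s)‖ ≤ _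
    rwa [sub_sub_sub_cancel_right, add_sub_add_right_eq_sub]
  have hg0 : ∀ l ∈ Sg, ∀ s, ‖g l s 0‖ ≤ eps s := fun l hl s => by
    have h : g l s 0 = -(y' l s - A s (y l s) - f l s (y l s)) := by
      change f l s (y l s + 0) + A s (y l s) - y' l s = _
      rw [add_zero]
      abel
    rw [h, norm_neg]
    exact hpse l hl s
  have hzd : ∀ l ∈ Sg, ∀ t, HasDerivAt (z l) (A t (z l t) + g l t (z l t)) t := fun l hl t => by
    refine ((hxsol l hl t).sub (hy l hl t)).congr_deriv ?_
    change _ = A t (x l t - y l t)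
      + (f l t (y l t + (x l t - y l t)) + A t (y l t) - y' l t)
    rw [map_sub, add_sub_cancel]
    abel
  have hyn : ∀ t, ContDiffOn ℝ ((k + 1 : ℕ) : WithTop ℕ∞) (fun l => y l t) Sg := fun t => by
    exact_mod_cast hyC t
  have hyn' : ∀ t, ContDiffOn ℝ ((k + 1 : ℕ) : WithTop ℕ∞) (fun l => y' l t) Sg := fun t => by
    exact_mod_cast hy'C t
  have hfn : ∀ t, ContDiffOn ℝ ((k + 1 : ℕ) : WithTop ℕ∞) (fun p : E × X => f p.1 t p.2)
      (Prod.fst ⁻¹' Sg) := fun t => by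
    have := hfC t
    rw [prod_univ] at this
    exact_mod_cast this
  have hgC : ∀ s, ContDiffOn ℝ ((k + 1 : ℕ) : WithTop ℕ∞) (fun p : E × X => g p.1 s p.2)
      (Prod.fst ⁻¹' Sg) := fun s => by
    have hy1 : ContDiffOn ℝ ((k + 1 : ℕ) : WithTop ℕ∞) (fun p : E × X => y p.1 s)
        (Prod.fst ⁻¹' Sg) := (hyn s).comp contDiffOn_fst fun _ hp => hp
    exact (((hfn s).comp (contDiffOn_fst.prodMk (hy1.add contDiffOn_snd)) fun _ hp => hp).add
      ((A s).contDiff.comp_contDiffOn hy1)).sub ((hyn' s).comp contDiffOn_fst fun _ hp => hp)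
  intro t
  suffices hzC : ContDiffOn ℝ k (fun l => z l t) Sg by
    have := hzC.add ((hyn t).of_le (by exact_mod_cast Nat.le_succ k))
    simp only [hz, sub_add_cancel] at this
    exact_mod_cast this
  rcases Nat.eq_zero_or_pos k with rfl | hk
  · rw [Nat.cast_zero, contDiffOn_zero]
    refine continuousOn_of_bounded_solution hTe hP hGr hnb hc hc0 hq1 hqint hq
      (fun s => (heps0 s).le) hLint hL hgc hglip hg0 hzd hxshad (fun s u => ?_) t
    exact (hgC s).continuousOn.comp (continuousOn_id.prodMk continuousOn_const) fun l hl => hl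
  intro l₀ hl₀
  obtain ⟨M, hM1, S₀, hS₀, hS₀S, hyM⟩ := hM l₀ hl₀
  obtain ⟨δ, hδ, hball⟩ := Metric.mem_nhds_iff.1 hS₀
  set S : Set E := Metric.ball l₀ δ with hS
  have hSo : IsOpen S := Metric.isOpen_ball
  have hSS : S ⊆ Sg := hball.trans hS₀S
  have hpre : (Prod.fst : E × X → E) ⁻¹' S ⊆ Prod.fst ⁻¹' Sg := preimage_mono hSS
  have hSo' : IsOpen ((Prod.fst : E × X → E) ⁻¹' S) := hSo.preimage continuous_fst
  have hSgo' : IsOpen ((Prod.fst : E × X → E) ⁻¹' Sg) := hSg.preimage continuous_fst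
  have hd : ∀ (h : E → X) (i : ℕ), ∀ l ∈ S,
      iteratedFDerivWithin ℝ i h S l = iteratedFDerivWithin ℝ i h Sg l := fun h i l hl =>
    (iteratedFDerivWithin_of_isOpen i hSo hl).trans
      (iteratedFDerivWithin_of_isOpen i hSg (hSS hl)).symm
  have hd' : ∀ (h : E × X → X) (i : ℕ), ∀ p : E × X, p.1 ∈ S →
      iteratedFDerivWithin ℝ i h (Prod.fst ⁻¹' S) p
        = iteratedFDerivWithin ℝ i h (Sg ×ˢ univ) p := fun h i p hp => by
    rw [prod_univ]
    exact (iteratedFDerivWithin_of_isOpen i hSo' hp).trans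
      (iteratedFDerivWithin_of_isOpen i hSgo' (hpre hp)).symm
  have hR1 : 1 ≤ R₀ + 1 := by linarith
  have hCn := contDiffOn_of_bounded_solution (S := S) (R := R₀ + 1)
    (K := R₀ + 1 + 1 + C + 2 * ((k + 1).factorial * (C * (R₀ + 1)) * (1 + M) ^ (k + 1)))
    hTe hP hGr hnb hc hc0 hq1 hqint hq heps (fun s => (heps0 s).le) hLint hL hSo
    (convex_ball _ _) (fun l hl => hgc l (hSS hl)) (fun l hl => hglip l (hSS hl))
    (fun l hl => hzd l (hSS hl)) (fun l hl => hxshad l (hSS hl)) (lt_add_one R₀) hk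
    (fun s => (hgC s).mono hpre) (by positivity) (fun i hi s p hp hpR => ?_) t
  · exact (hCn.contDiffAt (hSo.mem_nhds (Metric.mem_ball_self hδ))).contDiffWithinAt
  · refine norm_iteratedFDerivWithin_residual_le (f := fun p => f p.1 s p.2)
      (y := fun l => y l s) (y' := fun l => y' l s) hSo (by omega) hi ((hfn s).mono hpre)
      ((hyn s).mono hSS) ((hyn' s).mono hSS) (A s) hC.le (heps0 s).le (fun j hj2 hj p hp => ?_)
      (hc0 s) (fun l hl u v => hlip l (hSS hl) s u v) (fun l hl => hpse l (hSS hl) s)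
      (fun j hj1 hj l hl => ?_) hp (by linarith) (fun j hj1 hj => ?_) hR1 hpR
    · rw [hd' _ _ _ hp]
      exact hfbound j hj2 hj s p.1 (hSS hp) p.2
    · rw [hd _ _ _ hl, hd _ _ _ hl, hd _ _ _ hl]
      exact hR2 j hj1 hj s l (hSS hl)
    · rw [hd _ _ _ hp]
      exact hyM p.1 (hball hp) j hj1 hj s
end
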